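/- For every natural number n ≥ 10 there exists a maxnil graph with n vertices and exactly 3n − 5 edges. -/

import Mathlib

open SimpleGraph

/-- `H` is a minor of `G`: there is a family of nonempty, pairwise disjoint,
connected branch sets in `G`, one for each vertex of `H`, with an edge of `G`
between the branch sets of any two adjacent vertices of `H`. -/
def IsMinor {W V : Type} (H : SimpleGraph W) (G : SimpleGraph V) : Prop :=
  ∃ f : W → Set V,
    (∀ w, (f w).Nonempty) ∧
    (∀ w, (G.induce (f w)).Connected) ∧
    (Pairwise fun w₁ w₂ => Disjoint (f w₁) (f w₂)) ∧
    ∀ ⦃w₁ w₂⦄, H.Adj w₁ w₂ → ∃ v₁ ∈ f w₁, ∃ v₂ ∈ f w₂, G.Adj v₁ v₂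

/-- The result of a `∇Y`-move on the triangle `a b c` of `G`: delete the edges of
the triangle and add a new vertex (`none`) joined to `a`, `b`, `c`. -/
def triangleY {V : Type} (G : SimpleGraph V) (a b c : V) : SimpleGraph (Option V) :=
  (SimpleGraph.map Function.Embedding.some
      (G.deleteEdges {s(a, b), s(b, c), s(a, c)})) ⊔
    SimpleGraph.fromEdgeSet {s((none : Option V), some a), s(none, some b), s(none, some c)}

/-- Membership in the Petersen family: the graphs obtained from `K₆` by
`∇Y`-moves and `Y∇`-moves (the inverse operation), up to isomorphism. -/
inductive IsPetersenFamily : ∀ {V : Type}, SimpleGraph V → Prop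
  | k6 : IsPetersenFamily (⊤ : SimpleGraph (Fin 6))
  | deltaY {V : Type} {G : SimpleGraph V} {a b c : V} :
      IsPetersenFamily G → G.Adj a b → G.Adj b c → G.Adj a c →
      IsPetersenFamily (triangleY G a b c)
  | yDelta {V : Type} {G : SimpleGraph V} {a b c : V} :
      IsPetersenFamily (triangleY G a b c) → G.Adj a b → G.Adj b c → G.Adj a c →
      IsPetersenFamily G
  | iso {V W : Type} {G : SimpleGraph V} {H : SimpleGraph W} :
      IsPetersenFamily G → G ≃g H → IsPetersenFamily H

/-- A graph is linklessly embeddable (nIL) iff it has no minor in the Petersen family. -/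
def IsLinkless {V : Type} (G : SimpleGraph V) : Prop :=
  ∀ ⦃W : Type⦄ (P : SimpleGraph W), IsPetersenFamily P → ¬ IsMinor P G

/-- The graph obtained from `G` by adding the edge `ab`. -/
def addEdge {V : Type} (G : SimpleGraph V) (a b : V) : SimpleGraph V :=
  G ⊔ SimpleGraph.fromEdgeSet {s(a, b)}

/-- A nIL graph is maxnil if adding any edge yields a graph that is not nIL. -/
def IsMaxnil {V : Type} (G : SimpleGraph V) : Prop :=
  IsLinkless G ∧ ∀ a b : V, a ≠ b → ¬ G.Adj a b → ¬ IsLinkless (addEdge G a b)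

/-- `S` is a vertex cut set of the connected graph `G` if `G - S` is disconnected. -/
def IsVertexCut {V : Type} (G : SimpleGraph V) (S : Set V) : Prop :=
  G.Connected ∧ ¬ (G.induce Sᶜ).Preconnected

/-- A vertex cut set is minimal if no proper subset of it is a vertex cut set. -/
def IsMinimalVertexCut {V : Type} (G : SimpleGraph V) (S : Set V) : Prop :=
  IsVertexCut G S ∧ ∀ S' ⊂ S, ¬ IsVertexCut G S'

/-- A set `T` of vertices of `H` (inducing a `K₄`) is strongly separating if `H - T`
has at least two connected components such that every vertex of `T` has a
neighbor in each of them. -/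
def StronglySeparating {V : Type} (H : SimpleGraph V) (T : Set V) : Prop :=
  ∃ C₁ C₂ : (H.induce Tᶜ).ConnectedComponent, C₁ ≠ C₂ ∧
    ∀ v ∈ T, (∃ u ∈ C₁.supp, H.Adj v ↑u) ∧ (∃ u ∈ C₂.supp, H.Adj v ↑u)

/-- `G` is maximal without a `K₆` minor. -/
def IsMaximalK6MinorFree {V : Type} (G : SimpleGraph V) : Prop :=
  ¬ IsMinor (⊤ : SimpleGraph (Fin 6)) G ∧
    ∀ a b : V, a ≠ b → ¬ G.Adj a b → IsMinor (⊤ : SimpleGraph (Fin 6)) (addEdge G a b)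


/-! ### Minor models -/

/-- `f` is a minor model of `P` in `G`. -/
structure Model {W V : Type} (P : SimpleGraph W) (G : SimpleGraph V) (f : W → Set V) : Prop where
  conn : ∀ w, (G.induce (f w)).Connected
  disj : ∀ w₁ w₂ v, v ∈ f w₁ → v ∈ f w₂ → w₁ = w₂
  adj : ∀ w₁ w₂, P.Adj w₁ w₂ → ∃ v₁ ∈ f w₁, ∃ v₂ ∈ f w₂, G.Adj v₁ v₂

theorem isMinor_iff {W V : Type} (P : SimpleGraph W) (G : SimpleGraph V) :
    IsMinor P G ↔ ∃ f, Model P G f := by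
  constructor
  · rintro ⟨f, h1, h2, h3, h4⟩
    refine ⟨f, h2, ?_, fun w₁ w₂ h => h4 h⟩
    intro w₁ w₂ v hv1 hv2
    by_contra hne
    exact Set.disjoint_left.1 (h3 hne) hv1 hv2
  · rintro ⟨f, h⟩
    refine ⟨f, fun w => ?_, h.conn, ?_, fun w₁ w₂ h' => h.adj w₁ w₂ h'⟩
    · obtain ⟨x⟩ := (h.conn w).nonempty
      exact ⟨x.1, x.2⟩
    · intro w₁ w₂ hne
      exact Set.disjoint_left.2 fun v h1 h2 => hne (h.disj _ _ _ h1 h2)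

/-- Connected image of a connected set. -/
theorem conn_image {V V' : Type} {G : SimpleGraph V} {H : SimpleGraph V'} {s : Set V} (φ : V → V')
    (hs : (G.induce s).Connected)
    (h1 : ∀ x ∈ s, ∀ y ∈ s, G.Adj x y → φ x = φ y ∨ H.Adj (φ x) (φ y)) :
    (H.induce (φ '' s)).Connected := by
  have key : ∀ x y : s, (G.induce s).Walk x y →
      (H.induce (φ '' s)).Reachable ⟨φ x, x, x.2, rfl⟩ ⟨φ y, y, y.2, rfl⟩ := by
    intro x y p
    induction p with
    | nil => exact SimpleGraph.Reachable.refl _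
    | @cons a b c h p ih =>
      refine SimpleGraph.Reachable.trans ?_ ih
      have h' : G.Adj a b := h
      rcases h1 a a.2 b b.2 h' with he | ha
      · have : (⟨φ a, a, a.2, rfl⟩ : φ '' s) = ⟨φ b, b, b.2, rfl⟩ := Subtype.ext he
        rw [this]
      · exact SimpleGraph.Adj.reachable ha
  rw [SimpleGraph.connected_iff]
  constructor
  · rintro ⟨_, x, hx, rfl⟩ ⟨_, y, hy, rfl⟩
    obtain ⟨p⟩ := hs.preconnected ⟨x, hx⟩ ⟨y, hy⟩
    exact key _ _ p
  · obtain ⟨x⟩ := hs.nonempty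
    exact ⟨⟨φ x, x, x.2, rfl⟩⟩

/-- Pushing a model forward along a map. -/
theorem Model.map {W V V' : Type} {P : SimpleGraph W} {G : SimpleGraph V} {H : SimpleGraph V'}
    {f : W → Set V} (hf : Model P G f) (φ : V → V')
    (h1 : ∀ w, ∀ x ∈ f w, ∀ y ∈ f w, G.Adj x y → φ x = φ y ∨ H.Adj (φ x) (φ y))
    (h2 : ∀ w₁ w₂, P.Adj w₁ w₂ → ∃ v₁ ∈ f w₁, ∃ v₂ ∈ f w₂, H.Adj (φ v₁) (φ v₂))
    (hd : ∀ w₁ w₂, ∀ x ∈ f w₁, ∀ y ∈ f w₂, φ x = φ y → w₁ = w₂) :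
    Model P H (fun w => φ '' f w) := by
  refine ⟨fun w => conn_image φ (hf.conn w) (h1 w), ?_, ?_⟩
  · rintro w₁ w₂ _ ⟨x, hx, rfl⟩ ⟨y, hy, hxy⟩
    exact hd _ _ x hx y hy hxy.symm
  · intro w₁ w₂ h
    obtain ⟨v₁, m1, v₂, m2, ha⟩ := h2 w₁ w₂ h
    exact ⟨_, ⟨v₁, m1, rfl⟩, _, ⟨v₂, m2, rfl⟩, ha⟩

/-- Pushing a model forward along a map that identifies only two vertices `a`, `b`. -/
theorem Model.contract {W V V' : Type} {P : SimpleGraph W} {G : SimpleGraph V}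
    {H : SimpleGraph V'} {f : W → Set V} (hf : Model P G f) (φ : V → V') (a b : V)
    (h1 : ∀ x y, G.Adj x y → φ x = φ y ∨ H.Adj (φ x) (φ y))
    (hi : ∀ x y, φ x = φ y → x = y ∨ (x = a ∧ y = b) ∨ (x = b ∧ y = a))
    (hab : ∀ w₁ w₂, a ∈ f w₁ → b ∈ f w₂ → w₁ = w₂) : IsMinor P H := by
  have hd : ∀ w₁ w₂, ∀ x ∈ f w₁, ∀ y ∈ f w₂, φ x = φ y → w₁ = w₂ := by
    intro w₁ w₂ x hx y hy h
    rcases hi x y h with rfl | ⟨rfl, rfl⟩ | ⟨rfl, rfl⟩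
    · exact hf.disj _ _ _ hx hy
    · exact hab _ _ hx hy
    · exact (hab _ _ hy hx).symm
  refine (isMinor_iff _ _).2 ⟨_, hf.map φ (fun w x _ y _ h => h1 x y h) ?_ hd⟩
  intro w₁ w₂ h
  obtain ⟨v₁, m1, v₂, m2, ha⟩ := hf.adj w₁ w₂ h
  refine ⟨v₁, m1, v₂, m2, ?_⟩
  rcases h1 _ _ ha with he | h'
  · exact absurd (hd _ _ _ m1 _ m2 he) h.ne
  · exact h'

/-- A member of a branch set with at least two elements has a neighbour in the branch set. -/
theorem Model.exists_nbr {W V : Type} {P : SimpleGraph W} {G : SimpleGraph V}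
    {f : W → Set V} (hf : Model P G f) {w : W} {x y : V} (hx : x ∈ f w) (hy : y ∈ f w)
    (hne : x ≠ y) : ∃ z ∈ f w, G.Adj x z := by
  obtain ⟨p⟩ := (hf.conn w).preconnected ⟨x, hx⟩ ⟨y, hy⟩
  cases p with
  | nil => exact absurd rfl hne
  | @cons _ b _ h p => exact ⟨b.1, b.2, h⟩

/-- Minors of a contraction are minors. -/
theorem IsMinor.lift {W V V' : Type} {P : SimpleGraph W} {G : SimpleGraph V}
    {H : SimpleGraph V'} (h : IsMinor P H) (φ : V → V') (hs : Function.Surjective φ)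
    (hfib : ∀ x y, φ x = φ y → x = y ∨ G.Adj x y)
    (hadj : ∀ a b, H.Adj a b → ∃ x y, φ x = a ∧ φ y = b ∧ G.Adj x y) : IsMinor P G := by
  obtain ⟨f, hf⟩ := (isMinor_iff _ _).1 h
  refine (isMinor_iff _ _).2 ⟨fun w => φ ⁻¹' f w, ?_, ?_, ?_⟩
  · intro w
    have fib : ∀ x y : (φ ⁻¹' f w), φ x = φ y → (G.induce (φ ⁻¹' f w)).Reachable x y := by
      intro x y hxy
      rcases hfib _ _ hxy with he | ha
      · rw [Subtype.ext he]
      · exact SimpleGraph.Adj.reachable ha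
    have key : ∀ a b : f w, (H.induce (f w)).Walk a b → ∀ x y : (φ ⁻¹' f w),
        φ x = a → φ y = b → (G.induce (φ ⁻¹' f w)).Reachable x y := by
      intro a b p
      induction p with
      | nil => exact fun x y h1 h2 => fib x y (h1.trans h2.symm)
      | @cons a b c h p ih =>
        intro x y hx hy
        obtain ⟨x', z, h1, h2, h3⟩ := hadj a b h
        have m1 : x' ∈ φ ⁻¹' f w := by simp [h1]
        have m2 : z ∈ φ ⁻¹' f w := by simp [h2]
        refine (fib x ⟨x', m1⟩ (hx.trans h1.symm)).trans
          (SimpleGraph.Reachable.trans ?_ (ih ⟨z, m2⟩ y h2 hy))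
        exact SimpleGraph.Adj.reachable (G := G.induce (φ ⁻¹' f w)) (u := ⟨x', m1⟩) (v := ⟨z, m2⟩) h3
    rw [SimpleGraph.connected_iff]
    constructor
    · intro x y
      obtain ⟨p⟩ := (hf.conn w).preconnected ⟨φ x, x.2⟩ ⟨φ y, y.2⟩
      exact key _ _ p _ _ rfl rfl
    · obtain ⟨a⟩ := (hf.conn w).nonempty
      obtain ⟨x, hx⟩ := hs a
      exact ⟨⟨x, by simp [hx]⟩⟩
  · exact fun w₁ w₂ v h1 h2 => hf.disj _ _ _ h1 h2
  · intro w₁ w₂ h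
    obtain ⟨v₁, m1, v₂, m2, ha⟩ := hf.adj _ _ h
    obtain ⟨x, y, rfl, rfl, h3⟩ := hadj _ _ ha
    exact ⟨x, m1, y, m2, h3⟩

/-- Being a minor is invariant under isomorphism of the small graph. -/
theorem IsMinor.of_iso {W W' V : Type} {P : SimpleGraph W} {P' : SimpleGraph W'}
    {G : SimpleGraph V} (e : P ≃g P') (h : IsMinor P' G) : IsMinor P G := by
  obtain ⟨f, hf⟩ := (isMinor_iff _ _).1 h
  refine (isMinor_iff _ _).2 ⟨fun w => f (e w), fun w => hf.conn _, ?_, ?_⟩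
  · exact fun w₁ w₂ v h1 h2 => e.injective (hf.disj _ _ _ h1 h2)
  · exact fun w₁ w₂ h => hf.adj _ _ (e.map_adj_iff.2 h)

/-! ### Graphs given by packed adjacency matrices -/

/-- Entry `(i, j)` of a packed `0/1` matrix with rows of 16 bits. -/
def bit (M i j : ℕ) : Bool :=
  Nat.beq (Nat.land (Nat.shiftRight M (Nat.add (Nat.mul 16 i) j)) 1) 1

/-- Digit number `k` of a packed list of 4-bit digits. -/
def dg (m k : ℕ) : ℕ := Nat.land (Nat.shiftRight m (Nat.mul 4 k)) 15

/-- Symmetrized adjacency. -/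
def adjb (M i j : ℕ) : Bool := !(Nat.beq i j) && (bit M i j || bit M j i)

theorem beq_dec (i j : ℕ) : Nat.beq i j = decide (i = j) := by
  rw [Bool.eq_iff_iff, Nat.beq_eq]
  simp

theorem adjb_iff (M i j : ℕ) :
    adjb M i j = true ↔ i ≠ j ∧ (bit M i j = true ∨ bit M j i = true) := by
  simp [adjb, beq_dec]

theorem adjb_comm (M i j : ℕ) : adjb M i j = adjb M j i := by
  rw [Bool.eq_iff_iff, adjb_iff, adjb_iff, or_comm, ne_comm]

/-- The graph on `Fin n` with packed adjacency matrix `M`. -/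
def gr (n M : ℕ) : SimpleGraph (Fin n) where
  Adj i j := adjb M i j = true
  symm := ⟨fun i j h => by rw [adjb_comm]; exact h⟩
  loopless := ⟨fun i h => by rw [adjb_iff] at h; exact h.1 rfl⟩

theorem gr_adj {n M : ℕ} (i j : Fin n) : (gr n M).Adj i j ↔ adjb M i j = true := Iff.rfl

/-- Number of vertices of the seven graphs of the Petersen family. -/
def psz : ℕ → ℕ
  | 0 => 6
  | 1 => 7
  | 2 => 7
  | 3 => 8
  | 4 => 8
  | 5 => 9
  | _ => 10

/-- Adjacency matrices of the seven graphs of the Petersen family. -/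
def pM : ℕ → ℕ
  | 0 => 37477567420506345890971710
  | 1 => 4436862935841734358119997046846
  | 2 => 3406913747601267680729460179070
  | 3 => 503663728943227062982931898076299422
  | 4 => 109041561714818809938981465403752618
  | 5 => 50363462236643166855123079038629269274710
  | _ => 7225664671062431302055065032743121093554143314

/-- Isomorphisms witnessing the results of `∇Y`-moves. -/
def dyTab : ℕ → List (ℕ × ℕ)
  | 0 => [(1, 102827331), (1, 102846531), (1, 103092291), (1, 106041411), (1, 102847491), (1, 103093251), (1, 106042371), (1, 103104771), (1, 106053891), (1, 106176771), (1, 102847536), (1, 103093296), (1, 106042416), (1, 103104816), (1, 106053936), (1, 106176816), (1, 103105296), (1, 106054416), (1, 106177296), (1, 106181136)]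
  | 1 => [(4, 1985156128), (3, 1698852913), (3, 1699160113), (3, 1702109233), (3, 1698853633), (3, 1699160833), (3, 1702109953), (3, 1698853648), (3, 1699160848), (3, 1702109968)]
  | 2 => [(3, 1949439568), (3, 1949700688), (3, 1983124048), (3, 1949455888), (3, 1951544848), (3, 1949717008), (3, 1983140368), (3, 1951805968), (3, 1985229328)]
  | 3 => [(5, 18881783856), (5, 18882240816), (5, 18913329936), (5, 26902745616)]
  | 4 => []
  | 5 => [(6, 105601316640)]
  | _ => []

/-- Isomorphisms witnessing the results of `Y∇`-moves. -/
def ydTab : ℕ → List (ℕ × ℕ)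
  | 0 => []
  | 1 => [(0, 5517840)]
  | 2 => []
  | 3 => [(1, 108205088), (1, 91497232), (2, 106181136)]
  | 4 => [(1, 121767217), (1, 106107936)]
  | 5 => [(3, 1988383233), (3, 1733526032), (3, 2222338306), (3, 1132941840), (3, 878084609), (3, 1446277378)]
  | 6 => [(5, 40925017665), (5, 36881839904), (5, 27237828913), (5, 32369608002), (5, 31517124656), (5, 36810524515), (5, 36257937744), (5, 40269658193), (5, 27164416372), (5, 31461541986)]
  | _ => []

/-- The seven graphs of the Petersen family. -/
def PG (i : ℕ) : SimpleGraph (Fin (psz i)) := gr (psz i) (pM i)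

/-! ### The classification of the Petersen family -/

theorem ty_some_some {V : Type} {G : SimpleGraph V} {a b c : V} (x y : V) :
    (triangleY G a b c).Adj (some x) (some y) ↔
      G.Adj x y ∧ ¬ ((x = a ∨ x = b ∨ x = c) ∧ (y = a ∨ y = b ∨ y = c)) := by
  have h0 : G.Adj x y → x ≠ y := fun h => h.ne
  simp only [triangleY, SimpleGraph.sup_adj, SimpleGraph.map_adj, SimpleGraph.deleteEdges_adj,
    SimpleGraph.fromEdgeSet_adj, Set.mem_insert_iff, Set.mem_singleton_iff, Sym2.eq_iff]
  constructor
  · rintro (⟨x', y', ⟨h1, h2⟩, h3, h4⟩ | ⟨h, -⟩)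
    · obtain rfl : x' = x := by simpa using h3
      obtain rfl : y' = y := by simpa using h4
      refine ⟨h1, ?_⟩
      have := h0 h1
      grind
    · simp at h
  · rintro ⟨h1, h2⟩
    refine Or.inl ⟨x, y, ⟨h1, ?_⟩, rfl, rfl⟩
    grind

theorem ty_none_some {V : Type} {G : SimpleGraph V} {a b c : V} (x : V) :
    (triangleY G a b c).Adj none (some x) ↔ (x = a ∨ x = b ∨ x = c) := by
  have h : ¬ (SimpleGraph.map Function.Embedding.some
      (G.deleteEdges {s(a, b), s(b, c), s(a, c)})).Adj none (some x) := by
    rw [SimpleGraph.map_adj]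
    rintro ⟨u, v, -, h, -⟩
    simp at h
  simp only [triangleY, SimpleGraph.sup_adj, h, false_or]
  simp

/-- Is `x` one of `a`, `b`, `c`? -/
def tri (a b c x : ℕ) : Bool := Nat.beq x a || Nat.beq x b || Nat.beq x c

theorem tri_iff (a b c x : ℕ) : tri a b c x = true ↔ (x = a ∨ x = b ∨ x = c) := by
  simp [tri, beq_dec, or_assoc]

/-- Correctness of an entry of the table `dyTab`. -/
def DyOk (n M m M' a b c s : ℕ) : Prop :=
  m = n + 1 ∧ (∀ x < n, adjb M' (dg s n) (dg s x) = tri a b c x) ∧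
  (∀ x < n + 1, dg s x < m) ∧ (∀ x < n + 1, ∀ y < n + 1, dg s x = dg s y → x = y) ∧
  (∀ x < n, ∀ y < n, adjb M' (dg s x) (dg s y) =
    (adjb M x y && !(tri a b c x && tri a b c y)))

instance (n M m M' a b c s : ℕ) : Decidable (DyOk n M m M' a b c s) := by
  unfold DyOk; infer_instance

theorem DyOk.iso {n M m M' s : ℕ} {a b c : Fin n} (h : DyOk n M m M' a b c s) :
    Nonempty (triangleY (gr n M) a b c ≃g gr m M') := by
  obtain ⟨rfl, h1, h2, h3, h4⟩ := h
  let g : Option (Fin n) → Fin (n + 1) := fun o =>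
    match o with
    | none => ⟨dg s n, h2 n (by omega)⟩
    | some x => ⟨dg s x, h2 x (by omega)⟩
  have gi : Function.Injective g := by
    intro o o' ho
    rcases o with _ | x <;> rcases o' with _ | y
    · rfl
    · have := h3 n (by omega) y (by omega) (congrArg Fin.val ho)
      omega
    · have := h3 x (by omega) n (by omega) (congrArg Fin.val ho)
      omega
    · have := h3 x (by omega) y (by omega) (congrArg Fin.val ho)
      rw [Fin.ext this]
  have gb : Function.Bijective g :=
    (Fintype.bijective_iff_injective_and_card g).2 ⟨gi, by simp⟩
  refine ⟨⟨Equiv.ofBijective g gb, ?_⟩⟩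
  intro o o'
  have key : ∀ x : Fin n, (gr (n + 1) M').Adj (g none) (g (some x)) ↔
      (triangleY (gr n M) a b c).Adj none (some x) := by
    intro x
    rw [ty_none_some, gr_adj]
    show adjb M' (dg s n) (dg s x) = true ↔ _
    rw [h1 x x.2, tri_iff]
    simp [Fin.ext_iff]
  show (gr (n + 1) M').Adj (g o) (g o') ↔ _
  rcases o with _ | x <;> rcases o' with _ | y
  · simp
  · exact key y
  · rw [SimpleGraph.adj_comm, key, SimpleGraph.adj_comm]
  · rw [ty_some_some, gr_adj]
    show adjb M' (dg s x) (dg s y) = true ↔ _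
    rw [h4 x x.2 y y.2]
    simp only [gr_adj, Bool.and_eq_true, Bool.not_eq_true', ← Bool.not_eq_true, tri_iff,
      Fin.ext_iff]

/-- Correctness of an entry of the table `ydTab`. -/
def YdOk (n M m M' x s : ℕ) : Prop :=
  n = m + 1 ∧ (∀ u < m, dg s u < n ∧ dg s u ≠ x) ∧
  (∀ u < m, ∀ v < m, dg s u = dg s v → u = v) ∧
  (∀ u < m, ∀ v < m, adjb M' u v =
    (adjb M (dg s u) (dg s v) || (!Nat.beq u v && adjb M x (dg s u) && adjb M x (dg s v))))

instance (n M m M' x s : ℕ) : Decidable (YdOk n M m M' x s) := by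
  unfold YdOk; infer_instance

theorem YdOk.iso {n M m M' s : ℕ} {x : Fin n} {V : Type} {G : SimpleGraph V} {a b c : V}
    (hab : G.Adj a b) (hbc : G.Adj b c) (hac : G.Adj a c)
    (e : gr n M ≃g triangleY G a b c) (hx : e x = none) (h : YdOk n M m M' x s) :
    Nonempty (gr m M' ≃g G) := by
  obtain ⟨rfl, h1, h2, h3⟩ := h
  let t : Fin m → Fin (m + 1) := fun u => ⟨dg s u, (h1 u u.2).1⟩
  have hne : ∀ u, ∃ y, e (t u) = some y := by
    intro u
    have : e (t u) ≠ none := by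
      rw [← hx]
      intro h
      have := congrArg Fin.val (e.injective h)
      exact (h1 u u.2).2 this
    exact Option.ne_none_iff_exists'.1 this
  choose g hg using hne
  have gi : Function.Injective g := by
    intro u v huv
    have : e (t u) = e (t v) := by rw [hg, hg, huv]
    have := congrArg Fin.val (e.injective this)
    exact Fin.ext (h2 u u.2 v v.2 this)
  have : Finite (Option V) := Finite.of_equiv _ e.toEquiv
  have : Finite V := Finite.of_injective (some : V → Option V) (Option.some_injective V)
  have hc : Nat.card V = m := by
    have h5 : Nat.card (Fin (m + 1)) = Nat.card (Option V) := Nat.card_congr e.toEquiv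
    rw [Finite.card_option] at h5
    simp at h5
    omega
  have gb : Function.Bijective g := by
    refine gi.bijective_of_nat_card_le ?_
    simp [hc]
  refine ⟨⟨Equiv.ofBijective g gb, ?_⟩⟩
  intro u v
  show G.Adj (g u) (g v) ↔ _
  have k1 : adjb M (dg s u) (dg s v) = true ↔
      (triangleY G a b c).Adj (some (g u)) (some (g v)) := by
    rw [← hg, ← hg, e.map_adj_iff]; rfl
  have k2 : ∀ u : Fin m, adjb M x (dg s u) = true ↔ (triangleY G a b c).Adj none (some (g u)) := by
    intro u
    rw [← hg, ← hx, e.map_adj_iff]; rfl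
  rw [gr_adj, h3 u u.2 v v.2]
  simp only [Bool.or_eq_true, Bool.and_eq_true, k1, k2, ty_some_some, ty_none_some]
  have k3 : (!Nat.beq u v) = true ↔ g u ≠ g v := by
    simp [beq_dec, gi.eq_iff, Fin.ext_iff]
  rw [k3]
  have := hab.symm
  have := hbc.symm
  have := hac.symm
  have h0 : G.Adj (g u) (g v) → g u ≠ g v := fun h => h.ne
  grind

/-- `x` has at least four neighbours. -/
def fourNbrs (n M x : ℕ) : Prop :=
  ∃ y₁ < n, adjb M x y₁ = true ∧ ∃ y₂ < y₁, adjb M x y₂ = true ∧ ∃ y₃ < y₂, adjb M x y₃ = true ∧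
    ∃ y₄ < y₃, adjb M x y₄ = true

instance (n M x : ℕ) : Decidable (fourNbrs n M x) := by
  unfold fourNbrs; infer_instance

set_option maxRecDepth 100000 in
theorem dy_check : ∀ i < 7, ∀ a < psz i, ∀ b < psz i, ∀ c < psz i,
    (adjb (pM i) a b && adjb (pM i) b c && adjb (pM i) a c) = true →
    ((dyTab i).any fun e => decide (DyOk (psz i) (pM i) (psz e.1) (pM e.1) a b c e.2)) = true := by
  decide +kernel

set_option maxRecDepth 100000 in
theorem yd_check : ∀ i < 7, ∀ x < psz i,
    (∃ e ∈ ydTab i, YdOk (psz i) (pM i) (psz e.1) (pM e.1) x e.2) ∨ fourNbrs (psz i) (pM i) x := by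
  decide +kernel

theorem tab_lt : (∀ i < 7, ∀ e ∈ dyTab i, e.1 < 7) ∧ (∀ i < 7, ∀ e ∈ ydTab i, e.1 < 7) := by
  decide +kernel

theorem k6_eq : ∀ a b : Fin 6, adjb (pM 0) a b = true ↔ a ≠ b := by
  decide +kernel

theorem family_classify {V : Type} {G : SimpleGraph V} (h : IsPetersenFamily G) :
    ∃ i < 7, Nonempty (PG i ≃g G) := by
  induction h with
  | k6 =>
    refine ⟨0, by omega, ⟨⟨Equiv.refl _, ?_⟩⟩⟩
    intro a b
    exact (k6_eq a b).symm
  | @deltaY V G a b c _ hab hbc hac ih =>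
    obtain ⟨i, hi, ⟨e⟩⟩ := ih
    have tr : ∀ x y, G.Adj x y → adjb (pM i) (e.symm x) (e.symm y) = true := by
      intro x y h
      exact (gr_adj _ _).1 (e.symm.map_adj_iff.2 h)
    have hc := dy_check i hi _ (e.symm a).2 _ (e.symm b).2 _ (e.symm c).2
      (by rw [tr _ _ hab, tr _ _ hbc, tr _ _ hac]; rfl)
    rw [List.any_eq_true] at hc
    obtain ⟨p, hp, hok⟩ := hc
    have hok := of_decide_eq_true hok
    obtain ⟨E⟩ := hok.iso
    refine ⟨p.1, tab_lt.1 i hi p hp, ⟨E.symm.trans ?_⟩⟩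
    refine ⟨Equiv.optionCongr e.toEquiv, ?_⟩
    intro o o'
    have hsy : ∀ (x : Fin (psz i)) y, e x = y ↔ x = e.symm y := by
      intro x y
      constructor
      · rintro rfl; simp
      · rintro rfl; simp
    have key : ∀ x, (triangleY G a b c).Adj none (some (e x)) ↔
        (triangleY (gr (psz i) (pM i)) (e.symm a) (e.symm b) (e.symm c)).Adj none (some x) := by
      intro x
      simp only [ty_none_some, hsy]
    rcases o with _ | x <;> rcases o' with _ | y
    · simp
    · exact key y
    · rw [SimpleGraph.adj_comm]
      refine (key x).trans ?_
      rw [SimpleGraph.adj_comm]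
    · show (triangleY G a b c).Adj (some (e x)) (some (e y)) ↔ _
      simp only [ty_some_some, hsy]
      rw [e.map_adj_iff]
      rfl
  | @yDelta V G a b c _ hab hbc hac ih =>
    obtain ⟨i, hi, ⟨e⟩⟩ := ih
    have hx : e (e.symm none) = none := by simp
    rcases yd_check i hi _ (e.symm none).2 with ⟨p, hp, hok⟩ | h4
    · exact ⟨p.1, tab_lt.2 i hi p hp, hok.iso hab hbc hac e hx⟩
    · exfalso
      obtain ⟨y₁, l1, a1, y₂, l2, a2, y₃, l3, a3, y₄, l4, a4⟩ := h4
      have key : ∀ y (hy : y < psz i), adjb (pM i) (e.symm none) y = true →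
          (e ⟨y, hy⟩ = some a ∨ e ⟨y, hy⟩ = some b ∨ e ⟨y, hy⟩ = some c) := by
        intro y hy h
        have h' : (PG i).Adj (e.symm none) ⟨y, hy⟩ := h
        rw [← e.map_adj_iff, hx] at h'
        rcases hz : e ⟨y, hy⟩ with _ | z
        · rw [hz] at h'; simp at h'
        · rw [hz, ty_none_some] at h'
          simpa using h'
      have inj : ∀ y (hy : y < psz i) z (hz : z < psz i), e ⟨y, hy⟩ = e ⟨z, hz⟩ → y = z := by
        intro y hy z hz h
        exact congrArg Fin.val (e.injective h)
      have k1 := key y₁ (by omega) a1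
      have k2 := key y₂ (by omega) a2
      have k3 := key y₃ (by omega) a3
      have k4 := key y₄ (by omega) a4
      have i12 := inj y₁ (by omega) y₂ (by omega)
      have i13 := inj y₁ (by omega) y₃ (by omega)
      have i14 := inj y₁ (by omega) y₄ (by omega)
      have i23 := inj y₂ (by omega) y₃ (by omega)
      have i24 := inj y₂ (by omega) y₄ (by omega)
      have i34 := inj y₃ (by omega) y₄ (by omega)
      grind
  | @iso V W G H _ e ih =>
    obtain ⟨i, hi, ⟨E⟩⟩ := ih
    exact ⟨i, hi, ⟨E.trans e⟩⟩

theorem family_dy (i j s a b c : ℕ) (ha : a < psz i) (hb : b < psz i) (hc : c < psz i)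
    (hi : IsPetersenFamily (gr (psz i) (pM i))) (hab : adjb (pM i) a b = true) (hbc : adjb (pM i) b c = true)
    (hac : adjb (pM i) a c = true) (hok : DyOk (psz i) (pM i) (psz j) (pM j) a b c s) :
    IsPetersenFamily (gr (psz j) (pM j)) := by
  obtain ⟨E⟩ := DyOk.iso (a := ⟨a, ha⟩) (b := ⟨b, hb⟩) (c := ⟨c, hc⟩) hok
  have h1 : (gr (psz i) (pM i)).Adj ⟨a, ha⟩ ⟨b, hb⟩ := hab
  have h2 : (gr (psz i) (pM i)).Adj ⟨b, hb⟩ ⟨c, hc⟩ := hbc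
  have h3 : (gr (psz i) (pM i)).Adj ⟨a, ha⟩ ⟨c, hc⟩ := hac
  exact (IsPetersenFamily.deltaY hi h1 h2 h3).iso E

theorem family_yd (i j s a b c : ℕ) (ha : a < psz i) (hb : b < psz i) (hc : c < psz i)
    (hj : IsPetersenFamily (gr (psz j) (pM j))) (hab : adjb (pM i) a b = true) (hbc : adjb (pM i) b c = true)
    (hac : adjb (pM i) a c = true) (hok : DyOk (psz i) (pM i) (psz j) (pM j) a b c s) :
    IsPetersenFamily (gr (psz i) (pM i)) := by
  obtain ⟨E⟩ := DyOk.iso (a := ⟨a, ha⟩) (b := ⟨b, hb⟩) (c := ⟨c, hc⟩) hok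
  have h1 : (gr (psz i) (pM i)).Adj ⟨a, ha⟩ ⟨b, hb⟩ := hab
  have h2 : (gr (psz i) (pM i)).Adj ⟨b, hb⟩ ⟨c, hc⟩ := hbc
  have h3 : (gr (psz i) (pM i)).Adj ⟨a, ha⟩ ⟨c, hc⟩ := hac
  exact IsPetersenFamily.yDelta (hj.iso E.symm) h1 h2 h3

theorem family_mem : ∀ i < 7, IsPetersenFamily (PG i) := by
  have h0 : IsPetersenFamily (PG 0) := by
    refine IsPetersenFamily.iso IsPetersenFamily.k6 ⟨Equiv.refl _, ?_⟩
    intro a b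
    exact k6_eq a b
  have h1 : IsPetersenFamily (PG 1) := by
    refine family_dy 0 1 102827331 0 1 2 ?_ ?_ ?_ h0 ?_ ?_ ?_ ?_ <;> decide +kernel
  have h4 : IsPetersenFamily (PG 4) := by
    refine family_dy 1 4 1985156128 0 1 2 ?_ ?_ ?_ h1 ?_ ?_ ?_ ?_ <;> decide +kernel
  have h3 : IsPetersenFamily (PG 3) := by
    refine family_dy 1 3 1698852913 0 1 3 ?_ ?_ ?_ h1 ?_ ?_ ?_ ?_ <;> decide +kernel
  have h2 : IsPetersenFamily (PG 2) := by
    refine family_yd 2 3 1949439568 0 1 2 ?_ ?_ ?_ h3 ?_ ?_ ?_ ?_ <;> decide +kernel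
  have h5 : IsPetersenFamily (PG 5) := by
    refine family_dy 3 5 18881783856 0 1 2 ?_ ?_ ?_ h3 ?_ ?_ ?_ ?_ <;> decide +kernel
  have h6 : IsPetersenFamily (PG 6) := by
    refine family_dy 5 6 105601316640 0 1 2 ?_ ?_ ?_ h5 ?_ ?_ ?_ ?_ <;> decide +kernel
  intro i hi
  interval_cases i <;> assumption

/-- Linklessness in terms of the seven concrete graphs. -/
theorem isLinkless_iff {V : Type} (G : SimpleGraph V) :
    IsLinkless G ↔ ∀ i < 7, ¬ IsMinor (PG i) G := by
  constructor
  · exact fun h i hi => h _ (family_mem i hi)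
  · intro h W P hP hm
    obtain ⟨i, hi, ⟨e⟩⟩ := family_classify hP
    exact h i hi (IsMinor.of_iso e hm)

/-! ### Boolean combinators with fast kernel evaluation -/

/-- Call-by-value application: the kernel evaluates `x` before passing it on. -/
noncomputable def force (x : ℕ) (k : ℕ → Bool) : Bool :=
  Nat.rec (motive := fun _ => Bool) (k 0) (fun m _ => k (Nat.succ m)) x

/-- Bounded universal quantification. -/
noncomputable def fall (n : ℕ) (k : ℕ → Bool) : Bool :=
  Nat.rec (motive := fun _ => Bool) true (fun m ih => Bool.rec false ih (k m)) n

/-- Bounded existential quantification. -/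
noncomputable def fany (n : ℕ) (k : ℕ → Bool) : Bool :=
  Nat.rec (motive := fun _ => Bool) false (fun m ih => Bool.rec ih true (k m)) n

/-- Conjunction. -/
noncomputable def band (a b : Bool) : Bool := Bool.rec false b a

/-- Disjunction. -/
noncomputable def bor (a b : Bool) : Bool := Bool.rec b true a

/-- Negation. -/
noncomputable def bnot (a : Bool) : Bool := Bool.rec true false a

theorem force_eq (x : ℕ) (k : ℕ → Bool) : force x k = k x := by
  cases x <;> rfl

theorem fall_iff (n : ℕ) (k : ℕ → Bool) : fall n k = true ↔ ∀ m < n, k m = true := by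
  induction n with
  | zero => simp [fall]
  | succ n ih =>
    have h : fall (n + 1) k = Bool.rec false (fall n k) (k n) := rfl
    rw [h]
    constructor
    · intro h' m hm
      cases hk : k n
      · rw [hk] at h'; cases h'
      · rw [hk] at h'
        rcases Nat.lt_succ_iff_lt_or_eq.1 hm with h1 | rfl
        · exact ih.1 h' m h1
        · exact hk
    · intro h'
      rw [h' n (by omega)]
      exact ih.2 fun m hm => h' m (by omega)

theorem fany_iff (n : ℕ) (k : ℕ → Bool) : fany n k = true ↔ ∃ m < n, k m = true := by
  induction n with
  | zero => simp [fany]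
  | succ n ih =>
    have h : fany (n + 1) k = Bool.rec (fany n k) true (k n) := rfl
    rw [h]
    constructor
    · intro h'
      cases hk : k n
      · rw [hk] at h'
        obtain ⟨m, hm, h2⟩ := ih.1 h'
        exact ⟨m, by omega, h2⟩
      · exact ⟨n, by omega, hk⟩
    · rintro ⟨m, hm, h'⟩
      cases hk : k n
      · rcases Nat.lt_succ_iff_lt_or_eq.1 hm with h1 | rfl
        · exact ih.2 ⟨m, h1, h'⟩
        · rw [hk] at h'; cases h'
      · rfl

theorem band_iff (a b : Bool) : band a b = true ↔ a = true ∧ b = true := by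
  cases a <;> cases b <;> decide

theorem bor_iff (a b : Bool) : bor a b = true ↔ a = true ∨ b = true := by
  cases a <;> cases b <;> decide

theorem bnot_iff (a : Bool) : bnot a = true ↔ ¬ a = true := by
  cases a <;> decide

theorem nbeq_iff (a b : ℕ) : Nat.beq a b = true ↔ a = b := by
  rw [Nat.beq_eq]

/-! ### Local properties of the graphs of the Petersen family -/

/-- The properties of the graphs of the Petersen family used for the induction. -/
structure Good {W : Type} (P : SimpleGraph W) : Prop where
  deg : ∀ w a b, ∃ x, P.Adj w x ∧ x ≠ a ∧ x ≠ b
  tri : ∀ w a b c, (∀ x, P.Adj w x → x = a ∨ x = b ∨ x = c) → P.Adj w a → P.Adj w b → ¬ P.Adj a b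
  pat : ∀ w₁ w₂ w₃ p q a b, w₁ ≠ w₂ → w₂ ≠ w₃ → w₁ ≠ w₃ →
    (∀ x, P.Adj w₁ x → x = a ∨ x = w₂ ∨ x = p ∨ x = q) →
    (∀ x, P.Adj w₂ x → x = w₁ ∨ x = w₃ ∨ x = p ∨ x = q) →
    (∀ x, P.Adj w₃ x → x = w₂ ∨ x = b ∨ x = p ∨ x = q) → False

/-- Row `w` of a packed matrix. -/
def row (M w : ℕ) : ℕ := Nat.land (Nat.shiftRight M (Nat.mul 16 w)) 65535

/-- Remove the elements of the bitmask `x` from the bitmask `r`. -/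
def clr (r x : ℕ) : ℕ := Nat.xor r (Nat.land r x)

/-- Bitmask of two elements. -/
def pr (a b : ℕ) : ℕ := Nat.lor (Nat.shiftLeft 1 a) (Nat.shiftLeft 1 b)

/-- Search for the forbidden pattern; the neighbourhood of `w₂` is examined first. -/
noncomputable def patAll (n M : ℕ) : Bool :=
  fall n fun w₂ => fall n fun w₁ => fall n fun w₃ => force (clr (row M w₂) (pr w₁ w₃)) fun r =>
  fall n fun p => fall n fun q => bnot (band (Nat.beq (clr r (pr p q)) 0)
    (band (bnot (Nat.beq w₁ w₂)) (band (bnot (Nat.beq w₂ w₃)) (band (bnot (Nat.beq w₁ w₃))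
    (band (fany n fun a => Nat.beq (clr (clr (row M w₁) (pr p q)) (pr a w₂)) 0)
    (fany n fun b => Nat.beq (clr (clr (row M w₃) (pr p q)) (pr w₂ b)) 0))))))

theorem pat_all : fall 7 (fun i => patAll (psz i) (pM i)) = true := by
  decide +kernel

theorem row_check : fall 7 (fun i => fall (psz i) fun w => fall 16 fun x => bor (bnot (bit (pM i) w x))
    (band (Nat.blt x (psz i)) (bnot (Nat.beq w x)))) = true := by
  decide +kernel

theorem deg_check : fall 7 (fun i => fall (psz i) fun w => fall (psz i) fun a => fall (psz i) fun b =>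
    fany (psz i) fun x => band (adjb (pM i) w x) (band (bnot (Nat.beq x a)) (bnot (Nat.beq x b)))) =
    true := by
  decide +kernel

theorem tri_check : fall 7 (fun i => fall (psz i) fun w => fall (psz i) fun a => fall (psz i) fun b =>
    bor (bnot (band (adjb (pM i) w a) (band (adjb (pM i) w b) (adjb (pM i) a b))))
    (fall (psz i) fun c =>
    fany (psz i) fun x => band (adjb (pM i) w x) (band (bnot (Nat.beq x a)) (band (bnot (Nat.beq x b))
      (bnot (Nat.beq x c)))))) = true := by
  decide +kernel

theorem bit_eq (M i j : ℕ) : bit M i j = M.testBit (16 * i + j) := by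
  unfold bit
  rw [beq_dec, Nat.testBit]
  have h : Nat.land (Nat.shiftRight M (Nat.add (Nat.mul 16 i) j)) 1 = 1 &&& (M >>> (16 * i + j)) := by
    rw [Nat.and_comm]; rfl
  rw [h]
  have : 1 &&& (M >>> (16 * i + j)) = (M >>> (16 * i + j)) % 2 := by
    rw [Nat.and_comm]; exact Nat.and_one_is_mod _
  rw [this]
  rcases Nat.mod_two_eq_zero_or_one (M >>> (16 * i + j)) with h | h <;> rw [h] <;> rfl

theorem row_testBit (M w x : ℕ) : (row M w).testBit x = (bit M w x && decide (x < 16)) := by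
  have h : row M w = (M >>> (16 * w)) &&& (2 ^ 16 - 1) := rfl
  rw [h, Nat.testBit_and, Nat.testBit_shiftRight, Nat.testBit_two_pow_sub_one, bit_eq]

theorem clr_testBit (r x y : ℕ) : (clr r x).testBit y = (r.testBit y && !x.testBit y) := by
  have h : clr r x = r ^^^ (r &&& x) := rfl
  rw [h, Nat.testBit_xor, Nat.testBit_and]
  cases r.testBit y <;> cases x.testBit y <;> rfl

theorem pr_testBit (a b x : ℕ) : (pr a b).testBit x = (decide (x = a) || decide (x = b)) := by
  have h : pr a b = (1 <<< a) ||| (1 <<< b) := rfl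
  rw [h]
  simp only [Nat.testBit_or, Nat.one_shiftLeft, Nat.testBit_two_pow, eq_comm]

theorem good_PG (i : ℕ) (hi : i < 7) : Good (PG i) := by
  have hrow := row_check
  simp only [fall_iff, bor_iff, bnot_iff, band_iff, nbeq_iff, Nat.blt_eq] at hrow
  have hdeg := deg_check
  simp only [fall_iff, fany_iff, bnot_iff, band_iff, nbeq_iff] at hdeg
  have htri := tri_check
  simp only [fall_iff, bor_iff, fany_iff, bnot_iff, band_iff, nbeq_iff] at htri
  have hpat := pat_all
  simp only [patAll, fall_iff, force_eq, fany_iff, bnot_iff, band_iff, nbeq_iff] at hpat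
  have hsub : ∀ w a b c d : Fin (psz i),
      (∀ x, (PG i).Adj w x → x = a ∨ x = b ∨ x = c ∨ x = d) →
      clr (clr (row (pM i) w) (pr a b)) (pr c d) = 0 := by
    intro w a b c d h
    apply Nat.eq_of_testBit_eq
    intro x
    rw [clr_testBit, clr_testBit, row_testBit, pr_testBit, pr_testBit, Nat.zero_testBit]
    by_contra hx
    rw [Bool.not_eq_false] at hx
    simp only [Bool.and_eq_true, Bool.not_eq_true', Bool.or_eq_false_iff, decide_eq_true_eq,
      decide_eq_false_iff_not] at hx
    obtain ⟨⟨⟨h1, h2⟩, h3, h4⟩, h5, h6⟩ := hx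
    rcases hrow i hi w w.2 x h2 with h7 | ⟨h7, h8⟩
    · exact h7 h1
    have := h ⟨x, h7⟩ ((adjb_iff _ _ _).2 ⟨h8, Or.inl h1⟩)
    simp only [Fin.ext_iff] at this
    tauto
  refine ⟨?_, ?_, ?_⟩
  · intro w a b
    obtain ⟨x, hx, h1, h2, h3⟩ := hdeg i hi w w.2 a a.2 b b.2
    exact ⟨⟨x, hx⟩, h1, fun h => h2 (congrArg Fin.val h), fun h => h3 (congrArg Fin.val h)⟩
  · intro w a b c h h1 h2 h3
    rcases htri i hi w w.2 a a.2 b b.2 with h4 | h4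
    · exact h4 ⟨h1, h2, h3⟩
    obtain ⟨x, hx, a1, a2, a3, a4⟩ := h4 c c.2
    rcases h ⟨x, hx⟩ a1 with h | h | h
    · exact a2 (congrArg Fin.val h)
    · exact a3 (congrArg Fin.val h)
    · exact a4 (congrArg Fin.val h)
  · intro w₁ w₂ w₃ p q a b h12 h23 h13 n1 n2 n3
    refine hpat i hi w₂ w₂.2 w₁ w₁.2 w₃ w₃.2 p p.2 q q.2 ⟨hsub _ _ _ _ _ n2, ?_, ?_, ?_, ?_, ?_⟩
    · exact fun h => h12 (Fin.ext h)
    · exact fun h => h23 (Fin.ext h)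
    · exact fun h => h13 (Fin.ext h)
    · refine ⟨a, a.2, hsub _ _ _ _ _ fun x hx => ?_⟩
      have := n1 x hx
      tauto
    · refine ⟨b, b.2, hsub _ _ _ _ _ fun x hx => ?_⟩
      have := n3 x hx
      tauto

/-! ### Searching for spanning subgraphs -/

/-- Quantification over the elements of a list. -/
noncomputable def lall {α : Type} (l : List α) (k : α → Bool) : Bool :=
  List.rec (motive := fun _ => Bool) true (fun a _ ih => band (k a) ih) l

/-- Quantification over the elements of a list. -/
noncomputable def lany {α : Type} (l : List α) (k : α → Bool) : Bool :=
  List.rec (motive := fun _ => Bool) false (fun a _ ih => bor (k a) ih) l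

theorem lall_iff {α : Type} (l : List α) (k : α → Bool) :
    lall l k = true ↔ ∀ a ∈ l, k a = true := by
  induction l with
  | nil => simp [lall]
  | cons a l ih =>
    have h : lall (a :: l) k = band (k a) (lall l k) := rfl
    rw [h, band_iff, ih]
    simp

theorem lany_iff {α : Type} (l : List α) (k : α → Bool) :
    lany l k = true ↔ ∃ a ∈ l, k a = true := by
  induction l with
  | nil => simp [lany]
  | cons a l ih =>
    have h : lany (a :: l) k = bor (k a) (lany l k) := rfl
    rw [h, bor_iff, ih]
    simp

/-- Intersect the candidate set with the neighbourhoods of the images of earlier neighbours. -/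
noncomputable def cnd1 (M as free : ℕ) (l : List ℕ) : ℕ :=
  List.rec (motive := fun _ => ℕ) free (fun o _ ih => Nat.land ih (row M (dg as o))) l

/-- Restrict the candidate set to vertices larger than given ones. -/
noncomputable def cnd2 (as c : ℕ) (l : List ℕ) : ℕ :=
  List.rec (motive := fun _ => ℕ) c
    (fun o _ ih => Nat.shiftLeft (Nat.shiftRight ih (Nat.succ (dg as o))) (Nat.succ (dg as o))) l

/-- Backtracking search for an embedding. -/
noncomputable def emb (n M : ℕ) (steps : List (List ℕ × List ℕ)) : ℕ → ℕ → Bool :=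
  List.rec (motive := fun _ => ℕ → ℕ → Bool) (fun _ _ => true)
    (fun s _ ih as free => force (cnd2 as (cnd1 M as free s.1) s.2) fun c =>
      fany n fun v => band (Nat.beq (Nat.land (Nat.shiftRight c v) 1) 1)
        (force (Nat.add (Nat.mul 16 as) v) fun as' =>
          force (Nat.xor free (Nat.shiftLeft 1 v)) fun free' => ih as' free')) steps

theorem tb_iff (c v : ℕ) : Nat.beq (Nat.land (Nat.shiftRight c v) 1) 1 = c.testBit v := by
  have := bit_eq c 0 v
  simp only [bit, Nat.mul_eq, Nat.add_eq] at this
  simpa using this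

theorem dg_eq (m k : ℕ) : dg m k = m / 16 ^ k % 16 := by
  have h : dg m k = (m >>> (4 * k)) &&& (2 ^ 4 - 1) := rfl
  rw [h, Nat.and_two_pow_sub_one_eq_mod, Nat.shiftRight_eq_div_pow, pow_mul]
  norm_num

theorem dg_lt (m k : ℕ) : dg m k < 16 := by
  rw [dg_eq]; exact Nat.mod_lt _ (by norm_num)

theorem dg_zero (as v : ℕ) (hv : v < 16) : dg (16 * as + v) 0 = v := by
  rw [dg_eq]; simp; omega

theorem dg_succ (as v o : ℕ) (hv : v < 16) : dg (16 * as + v) (o + 1) = dg as o := by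
  rw [dg_eq, dg_eq, pow_succ', ← Nat.div_div_eq_div_mul]
  congr 2
  omega

theorem cnd1_testBit (M as free v : ℕ) (l : List ℕ) (hv : v < 16) (hf : free.testBit v = true)
    (h : ∀ o ∈ l, bit M (dg as o) v = true) : (cnd1 M as free l).testBit v = true := by
  induction l with
  | nil => exact hf
  | cons o l ih =>
    have e : cnd1 M as free (o :: l) = cnd1 M as free l &&& row M (dg as o) := rfl
    rw [e, Nat.testBit_and, ih fun o ho => h o (List.mem_cons_of_mem _ ho), row_testBit,
      h o List.mem_cons_self]
    simp [hv]

theorem cnd2_testBit (as c v : ℕ) (l : List ℕ) (hc : c.testBit v = true)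
    (h : ∀ o ∈ l, dg as o < v) : (cnd2 as c l).testBit v = true := by
  induction l with
  | nil => exact hc
  | cons o l ih =>
    have e : cnd2 as c (o :: l) = (cnd2 as c l >>> (dg as o + 1)) <<< (dg as o + 1) := rfl
    have h1 := h o List.mem_cons_self
    rw [e, Nat.testBit_shiftLeft, Nat.testBit_shiftRight,
      show dg as o + 1 + (v - (dg as o + 1)) = v by omega,
      ih fun o ho => h o (List.mem_cons_of_mem _ ho)]
    simp
    omega

/-- `mm` is an embedding that follows the search plan. -/
def Follows (n M : ℕ) (mm : ℕ → ℕ) : List (List ℕ × List ℕ) → ℕ → Prop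
  | [], _ => True
  | s :: ss, k => (∀ o ∈ s.1, o < k ∧ bit M (mm (k - 1 - o)) (mm k) = true) ∧
      (∀ l ∈ s.2, l < k ∧ mm (k - 1 - l) < mm k) ∧ mm k < n ∧ (∀ j < k, mm j ≠ mm k) ∧
      Follows n M mm ss (k + 1)

theorem emb_complete (n M : ℕ) (hn : n ≤ 16) (mm : ℕ → ℕ) (steps : List (List ℕ × List ℕ)) :
    ∀ k as free, Follows n M mm steps k → (∀ o < k, dg as o = mm (k - 1 - o)) →
    (∀ v < n, (∀ j < k, mm j ≠ v) → free.testBit v = true) → emb n M steps as free = true := by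
  induction steps with
  | nil => intros; rfl
  | cons s ss ih =>
    intro k as free hF has hfree
    obtain ⟨h1, h2, h3, h4, h5⟩ := hF
    have e : emb n M (s :: ss) as free = force (cnd2 as (cnd1 M as free s.1) s.2) fun c =>
      fany n fun v => band (Nat.beq (Nat.land (Nat.shiftRight c v) 1) 1)
        (force (Nat.add (Nat.mul 16 as) v) fun as' =>
          force (Nat.xor free (Nat.shiftLeft 1 v)) fun free' => emb n M ss as' free') := rfl
    rw [e, force_eq, fany_iff]
    refine ⟨mm k, h3, ?_⟩
    rw [band_iff, tb_iff, force_eq, force_eq]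
    constructor
    · apply cnd2_testBit
      · apply cnd1_testBit _ _ _ _ _ (by omega) (hfree _ h3 h4)
        intro o ho
        rw [has o (h1 o ho).1]
        exact (h1 o ho).2
      · intro o ho
        rw [has o (h2 o ho).1]
        exact (h2 o ho).2
    · apply ih (k + 1) _ _ h5
      · intro o ho
        rcases o with _ | o
        · exact dg_zero _ _ (by omega)
        · refine (dg_succ _ _ _ (by omega)).trans ?_
          rw [has o (by omega)]
          congr 1
          omega
      · intro v hv hj
        show (free ^^^ (1 <<< mm k)).testBit v = true
        rw [Nat.testBit_xor, Nat.one_shiftLeft, Nat.testBit_two_pow,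
          hfree v hv fun j hj' => hj j (by omega)]
        have := hj k (by omega)
        simp [this]

/-- Search plans for spanning embeddings: for each vertex the positions of its earlier neighbours
and the positions of vertices with smaller image, counted backwards. -/
def plan : ℕ → List (List ℕ × List ℕ)
  | 0 => [([], []),
    ([0], [0]),
    ([1, 0], [0]),
    ([2, 1, 0], [0]),
    ([3, 2, 1, 0], [0]),
    ([4, 3, 2, 1, 0], [0])]
  | 1 => [([], []),
    ([0], [0]),
    ([1, 0], [0]),
    ([2, 1, 0], []),
    ([3, 2, 1], [0]),
    ([4, 3, 2], [0]),
    ([2, 1, 0], [])]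
  | 2 => [([], []),
    ([0], []),
    ([1, 0], [0]),
    ([2, 0], [1]),
    ([3, 2, 0], [1]),
    ([4, 2, 0], [1]),
    ([5, 4, 2, 0], [1])]
  | 3 => [([], []),
    ([0], []),
    ([1, 0], [0]),
    ([2, 0], [1]),
    ([3, 2, 0], [1]),
    ([2, 0], []),
    ([4, 2], []),
    ([6, 1, 0], [])]
  | 4 => [([], []),
    ([0], [0]),
    ([0], [1]),
    ([2, 0], [1]),
    ([2, 0], [1]),
    ([4, 2, 0], [1]),
    ([4, 2, 0], []),
    ([6, 4, 2], [])]
  | 5 => [([], []),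
    ([0], [0]),
    ([1, 0], [0]),
    ([1], []),
    ([3, 0], []),
    ([2, 1], []),
    ([5, 0], []),
    ([5, 0], [3]),
    ([5, 3, 0], [])]
  | _ => [([], []),
    ([0], [0]),
    ([0], [1]),
    ([0], [2]),
    ([3, 0], [2]),
    ([1], [4]),
    ([5, 0], [4]),
    ([5, 1], [4]),
    ([3, 0], [7]),
    ([6, 2, 0], [5])]

/-- Symmetries of the graphs of the Petersen family used to prune the search: an entry
`(i, j, t)` is an automorphism `t` that fixes all vertices before `i` and maps `i` to `j`. -/
def symTab : ℕ → List (ℕ × ℕ × ℕ)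
  | 0 => [(0, 1, 5517825),
    (0, 2, 5517570),
    (0, 3, 5513475),
    (0, 4, 5447940),
    (0, 5, 4399365),
    (1, 2, 5517600),
    (1, 3, 5513520),
    (1, 4, 5448000),
    (1, 5, 4399440),
    (2, 3, 5514000),
    (2, 4, 5448720),
    (2, 5, 4400400),
    (3, 4, 5456400),
    (3, 5, 4411920),
    (4, 5, 4534800)]
  | 1 => [(0, 1, 106181121),
    (0, 2, 106180866),
    (1, 2, 106180896),
    (3, 4, 106119696),
    (3, 5, 105075216),
    (4, 5, 105198096)]
  | 2 => [(1, 2, 90390816),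
    (1, 3, 106172976),
    (1, 4, 90382656),
    (1, 5, 104075856),
    (1, 6, 88285536),
    (2, 4, 106050576),
    (2, 6, 72496656),
    (3, 5, 104092176),
    (4, 6, 72757776)]
  | 3 => [(1, 2, 1969439008),
    (1, 3, 1985221168),
    (1, 4, 1969430848),
    (2, 4, 1985098768)]
  | 4 => [(0, 1, 1732584193),
    (0, 2, 1985228818),
    (0, 3, 1732583683),
    (0, 4, 1985097748),
    (0, 5, 1732452613),
    (1, 3, 1985221168),
    (1, 5, 1983124048),
    (2, 4, 1985098768),
    (3, 5, 1983140368)]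
  | 5 => [(0, 1, 23211491841),
    (0, 2, 31762956546),
    (1, 2, 32282923296),
    (3, 7, 22356062736)]
  | _ => [(0, 1, 590143960065),
    (0, 2, 435830341650),
    (0, 3, 517902434595),
    (0, 4, 504265646340),
    (0, 5, 654009897525),
    (0, 6, 516557447430),
    (0, 7, 451596009495),
    (0, 8, 434750558280),
    (0, 9, 503455285545),
    (1, 4, 375919813440),
    (1, 6, 517831144800),
    (2, 7, 589018060560),
    (3, 9, 229588242960)]

/-- The search plan only uses edges and symmetries of the graph. -/
noncomputable def planOk (M : ℕ) (S : List (ℕ × ℕ × ℕ)) (steps : List (List ℕ × List ℕ)) :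
    ℕ → Bool :=
  List.rec (motive := fun _ => ℕ → Bool) (fun _ => true)
    (fun s _ ih k => band
      (band (lall s.1 fun o => band (Nat.blt o k) (adjb M (k - 1 - o) k))
        (lall s.2 fun l => band (Nat.blt l k)
          (lany S fun t => band (Nat.beq t.1 (k - 1 - l)) (Nat.beq t.2.1 k))))
      (ih (k + 1))) steps

/-- The symmetries are injective homomorphisms with the stated values. -/
noncomputable def symOk (n M : ℕ) (t : ℕ × ℕ × ℕ) : Bool :=
  band (band (Nat.blt t.1 n) (band (Nat.blt t.1 t.2.1) (Nat.beq (dg t.2.2 t.1) t.2.1)))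
  (band (fall t.1 fun x => Nat.beq (dg t.2.2 x) x)
  (band (fall n fun x => Nat.blt (dg t.2.2 x) n)
  (fall n fun x => fall n fun y =>
    band (bor (Nat.beq x y) (bnot (Nat.beq (dg t.2.2 x) (dg t.2.2 y))))
      (bor (bnot (adjb M x y)) (adjb M (dg t.2.2 x) (dg t.2.2 y))))))

theorem plan_check : fall 7 (fun i => band (Nat.beq (plan i).length (psz i))
    (band (planOk (pM i) (symTab i) (plan i) 0) (lall (symTab i) fun t => symOk (psz i) (pM i) t))) =
    true := by
  decide +kernel

/-- Lexicographically minimal embeddings satisfy the symmetry breaking constraints. -/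
theorem exists_lexmin {N n : ℕ} {P : SimpleGraph (Fin N)} {G : SimpleGraph (Fin n)}
    (m₀ : Fin N → Fin n) (hi : Function.Injective m₀) (hh : ∀ x y, P.Adj x y → G.Adj (m₀ x) (m₀ y)) :
    ∃ m : Fin N → Fin n, Function.Injective m ∧ (∀ x y, P.Adj x y → G.Adj (m x) (m y)) ∧
      ∀ (i : Fin N) (t : Fin N → Fin N), Function.Injective t →
        (∀ x y, P.Adj x y → P.Adj (t x) (t y)) → (∀ x < i, t x = x) → t i ≠ i → m i < m (t i) := by
  obtain ⟨m, ⟨h1, h2⟩, hmin⟩ := Set.exists_min_image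
    {m : Fin N → Fin n | Function.Injective m ∧ ∀ x y, P.Adj x y → G.Adj (m x) (m y)}
    (fun m => toLex m) (Set.toFinite _) ⟨m₀, hi, hh⟩
  refine ⟨m, h1, h2, ?_⟩
  intro i t ht hP hfix hne
  have hle := hmin (m ∘ t) ⟨h1.comp ht, fun x y h => h2 _ _ (hP x y h)⟩
  by_contra hlt
  have hlt' : m (t i) < m i := lt_of_le_of_ne (not_lt.1 hlt) fun h => hne (h1 h)
  refine absurd hle (not_le.2 ?_)
  refine ⟨i, fun j hj => ?_, hlt'⟩
  show m (t j) = m j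
  rw [hfix j hj]

/-- Symmetry of the upper triangle of a packed matrix. -/
noncomputable def symmOk (n M : ℕ) : Bool :=
  fall n fun y => fall n fun x => bor (bnot (bit M y x)) (bit M x y)

theorem emb_sound {n M i : ℕ} (hi : i < 7) (hn : n ≤ 16) (hs : symmOk n M = true)
    (m₀ : Fin (psz i) → Fin n) (h1 : Function.Injective m₀)
    (h2 : ∀ x y, (PG i).Adj x y → (gr n M).Adj (m₀ x) (m₀ y)) :
    emb n M (plan i) 0 (Nat.sub (Nat.shiftLeft 1 n) 1) = true := by
  obtain ⟨m, m1, m2, m3⟩ := exists_lexmin m₀ h1 h2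
  have hp := plan_check
  simp only [fall_iff, band_iff, lall_iff, nbeq_iff] at hp
  obtain ⟨hlen, hpl, hsym⟩ := hp i hi
  simp only [symOk, fall_iff, band_iff, bor_iff, bnot_iff, nbeq_iff, Nat.blt_eq] at hsym
  simp only [symmOk, fall_iff, bor_iff, bnot_iff] at hs
  let mm : ℕ → ℕ := fun k => if h : k < psz i then m ⟨k, h⟩ else 0
  have hmm : ∀ k (h : k < psz i), mm k = m ⟨k, h⟩ := fun k h => by simp [mm, h]
  have hlt : ∀ t ∈ symTab i, t.2.1 < psz i → mm t.1 < mm t.2.1 := by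
    intro t ht h
    obtain ⟨⟨a1, a2, a3⟩, a4, a5, a6⟩ := hsym t ht
    have := m3 ⟨t.1, a1⟩ (fun x => ⟨dg t.2.2 x, a5 x x.2⟩) ?_ ?_ ?_ ?_
    · rw [hmm _ a1, hmm _ h]
      simpa [a3] using this
    · intro x y hxy
      have hxy := congrArg Fin.val hxy
      rcases (a6 x x.2 y y.2).1 with h | h
      · exact Fin.ext h
      · exact absurd hxy h
    · intro x y hxy
      rcases (a6 x x.2 y y.2).2 with h | h
      · exact absurd hxy h
      · exact h
    · intro x hx
      exact Fin.ext (a4 x hx)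
    · intro h
      have := congrArg Fin.val h
      simp only at this
      omega
  have key : ∀ steps k, steps.length + k = psz i → planOk (pM i) (symTab i) steps k = true →
      Follows n M mm steps k := by
    intro steps
    induction steps with
    | nil => intros; trivial
    | cons s ss ih =>
      intro k hk h
      have e : planOk (pM i) (symTab i) (s :: ss) k = band
        (band (lall s.1 fun o => band (Nat.blt o k) (adjb (pM i) (k - 1 - o) k))
        (lall s.2 fun l => band (Nat.blt l k)
          (lany (symTab i) fun t => band (Nat.beq t.1 (k - 1 - l)) (Nat.beq t.2.1 k))))
        (planOk (pM i) (symTab i) ss (k + 1)) := rfl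
      rw [e] at h
      simp only [band_iff, lall_iff, lany_iff, nbeq_iff, Nat.blt_eq] at h
      obtain ⟨⟨p1, p2⟩, p3⟩ := h
      rw [List.length_cons] at hk
      have hk' : k < psz i := by omega
      refine ⟨?_, ?_, ?_, ?_, ih (k + 1) (by omega) p3⟩
      · intro o ho
        refine ⟨(p1 o ho).1, ?_⟩
        have hl : k - 1 - o < psz i := by omega
        have := m2 ⟨k - 1 - o, hl⟩ ⟨k, hk'⟩ (p1 o ho).2
        rw [hmm _ hl, hmm _ hk']
        obtain ⟨-, h | h⟩ := (adjb_iff _ _ _).1 this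
        · exact h
        · exact (hs _ (Fin.is_lt _) _ (Fin.is_lt _)).resolve_left (fun h' => h' h)
      · intro l hl
        obtain ⟨q1, t, ht, q2, q3⟩ := p2 l hl
        refine ⟨q1, ?_⟩
        have := hlt t ht (by omega)
        rwa [q2, q3] at this
      · rw [hmm _ hk']; exact Fin.is_lt _
      · intro j hj h
        rw [hmm _ hk', hmm j (by omega)] at h
        have := congrArg Fin.val (m1 (Fin.ext h))
        simp only at this
        omega
  refine emb_complete n M hn mm (plan i) 0 0 _ (key _ 0 (by omega) hpl) (by intro o ho; omega) ?_
  intro v hv _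
  have : Nat.sub (Nat.shiftLeft 1 n) 1 = 2 ^ n - 1 := by
    show (1 <<< n) - 1 = _
    rw [Nat.one_shiftLeft]
  rw [this, Nat.testBit_two_pow_sub_one]
  simpa using hv

/-! ### Contraction certificates -/

/-- Pass element number `k` of a list to a test. -/
noncomputable def lget (l : List ℕ) : ℕ → (ℕ → Bool) → Bool :=
  List.rec (motive := fun _ => ℕ → (ℕ → Bool) → Bool) (fun _ _ => false)
    (fun a _ ih i k => Nat.rec (motive := fun _ => Bool) (k a) (fun j _ => ih j k) i) l

theorem lget_elim (l : List ℕ) : ∀ i k, lget l i k = true → ∃ a ∈ l, k a = true := by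
  induction l with
  | nil => intro i k h; cases h
  | cons a l ih =>
    intro i k h
    rcases i with _ | i
    · exact ⟨a, List.mem_cons_self, h⟩
    · obtain ⟨b, hb, h'⟩ := ih i k h
      exact ⟨b, List.mem_cons_of_mem _ hb, h'⟩

/-- The packed map `f` identifies only `a` and `b` and maps the graph `M` weakly
homomorphically to `M'`. -/
noncomputable def entOk (n M M' f a b : ℕ) : Bool :=
  fall (Nat.succ n) fun y => force (dg f y) fun j => band (Nat.blt j n)
    (fall y fun x => force (dg f x) fun i => bor (band (band (Nat.beq x a) (Nat.beq y b)) (Nat.beq i j))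
      (band (bnot (Nat.beq i j)) (bor (bnot (bit M x y)) (bit M' i j))))

/-- Check of the certificate of a graph with `n + 1` vertices. -/
noncomputable def grOk (n : ℕ) (prev : List ℕ) (p : ℕ × List (ℕ × List ℕ)) : Bool :=
  force p.1 fun M =>
  band (symmOk (Nat.succ n) M)
  (band (fall (Nat.succ n) fun x => fany (Nat.succ n) fun y => adjb M x y)
  (band (fall 7 fun i => bor (bnot (Nat.beq (psz i) (Nat.succ n)))
    (bnot (emb (Nat.succ n) M (plan i) 0 (Nat.sub (Nat.shiftLeft 1 (Nat.succ n)) 1))))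
  (band (fall (Nat.succ n) fun y => fall y fun x => bor (bnot (bit M x y))
    (lany p.2 fun g => lany g.2 fun e => Nat.beq (Nat.land e 255) (Nat.add (Nat.mul 16 x) y)))
  (lall p.2 fun g => lget prev g.1 fun M' => lall g.2 fun e =>
    entOk n M M' (Nat.shiftRight e 8) (dg e 1) (dg e 0)))))

/-- No graph of the Petersen family is a minor. -/
def LF (n M : ℕ) : Prop := ∀ i < 7, ¬ IsMinor (PG i) (gr n M)

theorem psz_ge (i : ℕ) : 6 ≤ psz i := by
  unfold psz
  split <;> norm_num

theorem LF_five (M : ℕ) : LF 5 M := by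
  intro i _ h
  obtain ⟨f, hf⟩ := (isMinor_iff _ _).1 h
  have hne : ∀ w, ∃ v, v ∈ f w := fun w => by
    obtain ⟨x⟩ := (hf.conn w).nonempty
    exact ⟨x.1, x.2⟩
  choose m hm using hne
  have hinj : Function.Injective m := fun a b hab => hf.disj _ _ _ (hm a) (hab ▸ hm b)
  have := Fintype.card_le_of_injective m hinj
  simp at this
  have := psz_ge i
  omega

theorem dg_byte (e x y : ℕ) (hy : y < 16) (hx : x < 16) (h : Nat.land e 255 = Nat.add (Nat.mul 16 x) y) :
    dg e 1 = x ∧ dg e 0 = y := by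
  have h' : e % 256 = 16 * x + y := by
    have h2 : Nat.land e 255 = 16 * x + y := h
    rw [← h2]
    exact (Nat.and_two_pow_sub_one_eq_mod e 8).symm
  rw [dg_eq, dg_eq]
  constructor <;> norm_num <;> omega

theorem level_sound (n : ℕ) (hn : n < 16) (prev : List ℕ) (hprev : ∀ M ∈ prev, LF n M)
    (p : ℕ × List (ℕ × List ℕ)) (hp : grOk n prev p = true) : LF (n + 1) p.1 := by
  rw [grOk, force_eq, band_iff, band_iff, band_iff, band_iff] at hp
  obtain ⟨hsymm, hdeg, hemb, hcov, hent⟩ := hp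
  have hsymm' := hsymm
  simp only [symmOk, fall_iff, bor_iff, bnot_iff] at hsymm
  simp only [fall_iff, fany_iff] at hdeg
  simp only [fall_iff, bor_iff, bnot_iff, nbeq_iff] at hemb
  simp only [fall_iff, bor_iff, bnot_iff, lany_iff, nbeq_iff] at hcov
  simp only [lall_iff] at hent
  intro i hi hm
  obtain ⟨f, hf⟩ := (isMinor_iff _ _).1 hm
  have bitlt : ∀ x y : Fin (n + 1), (gr (n + 1) p.1).Adj x y → bit p.1 x y = true := by
    intro x y h
    obtain ⟨-, h | h⟩ := (adjb_iff _ _ _).1 h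
    · exact h
    · exact (hsymm _ y.2 _ x.2).resolve_left (fun h' => h' h)
  -- no edge can be contracted
  have hlt : ∀ a b : Fin (n + 1), a < b → (gr (n + 1) p.1).Adj a b →
      ¬ (∀ w₁ w₂, a ∈ f w₁ → b ∈ f w₂ → w₁ = w₂) := by
    intro a b hab hadj hw
    obtain ⟨g, hg, e, he, hby⟩ := (hcov b b.2 a hab).resolve_left (fun h' => h' (bitlt a b hadj))
    obtain ⟨d1, d0⟩ := dg_byte e a b (by omega) (by omega) hby
    obtain ⟨M', hM', hall⟩ := lget_elim _ _ _ (hent g hg)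
    rw [lall_iff] at hall
    have hE := hall e he
    rw [d1, d0] at hE
    simp only [entOk, fall_iff, force_eq, band_iff, bor_iff, bnot_iff, nbeq_iff, Nat.blt_eq] at hE
    have hpair : ∀ x y : Fin (n + 1), x < y →
        ((x = a ∧ y = b) ∧ dg (Nat.shiftRight e 8) x = dg (Nat.shiftRight e 8) y) ∨
        (dg (Nat.shiftRight e 8) x ≠ dg (Nat.shiftRight e 8) y ∧
          ((gr (n + 1) p.1).Adj x y →
            bit M' (dg (Nat.shiftRight e 8) x) (dg (Nat.shiftRight e 8) y) = true)) := by
      intro x y hxy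
      rcases (hE y y.2).2 x hxy with h | ⟨h1, h2⟩
      · exact Or.inl ⟨⟨Fin.ext h.1.1, Fin.ext h.1.2⟩, h.2⟩
      · exact Or.inr ⟨h1, fun h => h2.resolve_left (fun h' => h' (bitlt x y h))⟩
    refine hprev M' hM' i hi (hf.contract
      (fun x => (⟨dg (Nat.shiftRight e 8) x, (hE x x.2).1⟩ : Fin n)) a b ?_ ?_ hw)
    · intro x y hxy
      rcases lt_or_gt_of_ne hxy.ne with h | h
      · rcases hpair x y h with ⟨-, hd⟩ | ⟨h1, h2⟩
        · exact Or.inl (Fin.ext hd)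
        · exact Or.inr ((adjb_iff _ _ _).2 ⟨h1, Or.inl (h2 hxy)⟩)
      · rcases hpair y x h with ⟨-, hd⟩ | ⟨h1, h2⟩
        · exact Or.inl (Fin.ext hd.symm)
        · exact Or.inr ((adjb_iff _ _ _).2 ⟨h1.symm, Or.inr (h2 hxy.symm)⟩)
    · intro x y hxy
      have hxy' : dg (Nat.shiftRight e 8) x = dg (Nat.shiftRight e 8) y := congrArg Fin.val hxy
      rcases lt_trichotomy x y with h | h | h
      · rcases hpair x y h with ⟨hd, -⟩ | ⟨h1, -⟩
        · exact Or.inr (Or.inl hd)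
        · exact absurd hxy' h1
      · exact Or.inl h
      · rcases hpair y x h with ⟨hd, -⟩ | ⟨h1, -⟩
        · exact Or.inr (Or.inr hd.symm)
        · exact absurd hxy'.symm h1
  have hno : ∀ a b : Fin (n + 1), (gr (n + 1) p.1).Adj a b →
      ¬ (∀ w₁ w₂, a ∈ f w₁ → b ∈ f w₂ → w₁ = w₂) := by
    intro a b h hw
    rcases lt_or_gt_of_ne h.ne with h' | h'
    · exact hlt a b h' h hw
    · exact hlt b a h' h.symm fun w₁ w₂ h1 h2 => (hw w₂ w₁ h2 h1).symm
  have hsing : ∀ w x y, x ∈ f w → y ∈ f w → x = y := by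
    intro w x y hx hy
    by_contra hne
    obtain ⟨z, hz, hxz⟩ := hf.exists_nbr hx hy hne
    exact hno x z hxz fun w₁ w₂ h1 h2 => (hf.disj _ _ _ h1 hx).trans (hf.disj _ _ _ hz h2)
  have hused : ∀ x, ∃ w, x ∈ f w := by
    intro x
    by_contra hx
    obtain ⟨y, hy, hxy⟩ := hdeg x x.2
    exact hno x ⟨y, hy⟩ hxy fun w₁ w₂ h1 _ => absurd ⟨w₁, h1⟩ hx
  have hne : ∀ w, ∃ v, v ∈ f w := fun w => by
    obtain ⟨x⟩ := (hf.conn w).nonempty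
    exact ⟨x.1, x.2⟩
  choose m hm using hne
  have hinj : Function.Injective m := fun a b hab => hf.disj _ _ _ (hm a) (hab ▸ hm b)
  have hsurj : Function.Surjective m := fun x => by
    obtain ⟨w, hw⟩ := hused x
    exact ⟨w, hsing w _ _ (hm w) hw⟩
  have hcard := Fintype.card_of_bijective ⟨hinj, hsurj⟩
  simp only [Fintype.card_fin] at hcard
  refine ((hemb i hi).resolve_left fun h => h hcard) (emb_sound hi (by omega) hsymm' m hinj ?_)
  intro x y hxy
  obtain ⟨v₁, h1, v₂, h2, h⟩ := hf.adj x y hxy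
  rwa [hsing _ _ _ (hm x) h1, hsing _ _ _ (hm y) h2]

set_option maxRecDepth 100000

/-- Contraction certificates for graphs with 6 vertices. -/
def lvl6 : List (ℕ × List (ℕ × List ℕ)) := [
  (37477530527018198470819902, [(0, [1126236161, 605040642, 604057603, 1077022724, 69283845,
    1126240274, 1125257235, 338825237, 605106211, 1110577188, 337719333, 1127354420,
    606154805, 1144131653])])]

/-- Contraction certificates for graphs with 7 vertices. -/
def lvl7 : List (ℕ × List (ℕ × List ℕ)) := [
  (4991481834807327570337234485374, [(0, [22601072641, 14245969922, 9714094083, 13961072644,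
    21545226245, 1126256646, 22601076754, 22601080851, 9750781974, 14246101027, 22585413668,
    9952182310, 13994627124, 22350532661, 9716191286, 22618968133, 14011404358, 22887403606])]),
  (3723833651287038702578937692286, [(0, [22601072641, 22066237442, 22598983683, 9936506884,
    21529497605, 1380126726, 18542108690, 22585352212, 17738965013, 9750781974, 18542174243,
    22318026788, 9986773030, 22602129460, 18544271413, 14045749302, 22334804037, 22871674966])])]

/-- Contraction certificates for graphs with 8 vertices. -/
def lvl8 : List (ℕ × List (ℕ × List ℕ)) := [
  (451744008643636678477340938525802750, [(0, [434917933057, 361415847938, 283837280259, 434867613700,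
    296454598661, 70166654982, 22651416583, 361416044562, 283840426003, 297259905045,
    83051556886, 228809846807, 361416241188, 283843571764, 298065211461, 95936458822,
    434968277063]), (1, [434918002723, 164605595687, 434920099893, 435188535382, 439483502695])]),
  (472513196082611618518973461685928190, [(0, [298015850497, 430385995779, 297965531140, 300734816261,
    276575625222, 18075426823, 95600062483, 434666287125, 82718306326, 229313163287,
    361421156404, 430389141557, 225036017719, 298066194501, 78423339078, 298032640071,
    302345429078, 293755494503]), (1, [434917871618, 434917937170, 434918002723, 369958719525])]),
  (430974821214333034348188841453355262, [(0, [417455210497, 361415847938, 95596916739, 361320493060,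
    416649916421, 345277280262, 23154733063, 361416044562, 95600062483, 361370824724,
    417455222805, 358162182166, 229313163287, 361415913507, 361415979045, 361421156404,
    369973342261, 362490703941, 362457149510, 298032640071, 371047084118, 366752116839])]),
  (555590262879305598676275676325871852, [(0, [289205723139, 276323966982, 83299140115, 70417383958,
    425805762851, 412924006694, 425470480948, 287779988789, 14327878711, 425520812614,
    288585295190, 220486308967]), (1, [434666213378, 434129350917, 95886115079, 297260879890,
    296405578004, 27166638359, 228725973028, 369371525445, 228507846231])]),
  (493283017334797562035099586097905918, [(0, [283840413697, 300952866818, 288065212419, 283739774980,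
    429533515781, 275183456262, 18827268103, 283840426003, 283840421910, 156064882711,
    300953063459, 300952997924, 164621324327, 283790106676, 430338822197, 288068358198,
    224985698359, 430070386757, 164655009862, 422084677703, 430607257686, 439197192295])]),
  (306349714015762952690035154282938622, [(0, [349557620737, 160578932738, 160575000579, 301455200260,
    300700225541, 276541034502, 18842013703, 349557633044, 348802658325, 349557641239,
    280836067363, 160579129380, 159824154661, 280836001830, 160578146356, 159823171637,
    280838164535, 301505531973, 289425936454, 225000443975, 302310838358, 431158874199])])]

/-- Contraction certificates for graphs with 9 vertices. -/
def lvl9 : List (ℕ × List (ℕ × List ℕ)) := [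
  (58190128023364582680097467083464097137132, [(0, [8131499266050, 8130693972229, 3669095419922,
    3667971752212, 5940245053476, 5939943063877]), (1, [7092148768771, 8110059163654,
    2294925426951, 1251251519752, 2226205950231, 159793938712, 6884867266339, 4814695126822,
    6886729601076, 7091024892981, 6886763155526, 8108935287894, 2423285744983, 1250227914072]),
    (2, [8131497296147, 3437421330710]), (3, [3806753591352, 8136080625767, 8204800102520])]),
  (63634728970690881961604443364571160314334, [(0, [5941016793345, 3466312695812, 5941016789268,
    7847985619223, 2706906620184, 5528699953479, 357563523400]), (1, [5734861775139,
    5734861381924, 5734861840678, 5734855483700, 3668979425592, 3643213750598, 5717681971559,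
    3535837471096]), (2, [3668993056771, 5704813846534, 3329695817735, 228731527176,
    3668997251125, 5721188409413, 5721993715798]), (4, [8131499266050, 8131499528229]), (5,
    [8067361149015, 5992895090776])]),
  (86773893595439866754245137165376424509724, [(0, [289121920824, 224681682760]), (1, [430890755842,
    430890754307, 302010278148, 430890754056, 499911954963, 306575512084, 507966997013,
    507966980632, 430890297128, 506893255256]), (2, [1251244795683, 1315606390564, 1461899719220,
    1606401925941, 1541898773317]), (4, [3455133685030, 3583888332071, 3468018586966,
    3790046762327, 3382085821800, 3510871926136]), (5, [5512389334583, 5722842732102,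
    5718547764839])]),
  (51384397607878702400932799231629907001854, [(0, [6954163376130, 5714253058051, 3667976654853,
    8110310821894, 7723763765255, 434666672136, 8131247738915, 2707241963560, 8131248787509,
    8131785658454, 8136080625767, 8204800102520]), (2, [5941033566209, 5941016793092]), (5,
    [1594060193810, 7913028534291, 3785030254613, 7784177549334, 6878208868375, 4497722458136,
    1594060259364, 7913029582900, 3785298690117, 7788472516678, 6946928345159, 5597234085960])]),
  (58189795706224434067155045148983752983022, [(0, [8130694217729, 5940010156309]), (1, [2294925426951,
    1267893403912, 5665934672147, 2226205950231, 168381776152, 3463156531512, 2569803333975,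
    3466916659544, 2363644903800]), (2, [8131497299971, 7086784319493, 3437421334534,
    7091298239506, 7092086902804, 3437421330710, 7091298567203, 7091298436134, 3463157583924,
    8130676327477, 3463191138374, 7082708501590]), (5, [7792449568770, 7792449699876,
    7792500031557])]),
  (50023268140194953382745685771241322775038, [(0, [5940496826369]), (2, [8131245641731, 8126888808452,
    8130443481093, 8110310821894, 7723763765255, 508218707976, 8131246690323, 8126905585684,
    8130711916565, 8114605789206, 7792483242007, 1607730335768, 8131248787509, 8127490691142,
    7998641672263, 4906265219144, 8131785658454, 8136080625767, 8204800102520]), (5,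
    [1594059931650, 1594060193810, 1594060324899, 1594060062757, 1594059276340, 6748827107397])]),
  (75884644970352767696606767204762336690686, [(1, [3648155557891, 3575108497414, 288385036296]), (2,
    [5641275977730, 5641175707652, 1258530746373, 5641276239907, 5641276370980, 4883970547752,
    5641242816564, 1259604488245, 4883966418998, 1599121547320, 1260141359173, 5641192484934,
    1260057473096, 1259872923734, 1243229794408]), (4, [7792483237889, 7723763765255,
    7792483250195, 7852646285334, 7792483242007, 4565922824216, 8136080625767, 8204800102520])]),
  (74523515502669018678456547232589889995262, [(1, [5709991518211, 7972853014534]), (2, [3459127902209,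
    5641275977730, 5640907337732, 5639397388293, 3321688956935, 499609919496, 3459127906323,
    7096176361494, 3459127910423, 3459127914520, 5641276239907, 5641276370980, 5641276436517,
    5640974446644, 5640471130165, 4884771528758, 1599121547320, 5641008001093, 5641192484934,
    1260057473096, 5639665823830, 3665286340711, 4897656430696, 3527847387256])]),
  (75884644970352772532291598919342764917230, [(1, [5649828548865, 3648155557891, 5581109076231,
    5649828544787, 5649828557078, 5649828552983, 3459126866200, 3643810455862, 358428844344,
    5718548029799, 5855986983288]), (2, [5641275977730, 1258530746373, 4879704875014,
    499609919496, 5636981272867, 5641276370980, 1581392290853, 486175433768, 5641242816564,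
    160092860725, 1260141359173, 5641192484934, 1260057473096, 1580586984534, 482413339752])]),
  (63634147423459824048080233673902044021222, [(1, [169186767106, 143433085190, 168683573256,
    3599537014546, 8131245637907, 8118298018068, 3573720418070, 5666739597603, 3599537080101,
    3462935221542, 5666743791924, 8131248783669, 3462938300472, 8118348349765, 5636612370758,
    3458580484168, 3578015385430]), (2, [3462100615169, 3461832183813, 159290491672,
    1258802119512]), (3, [2230719950855, 2436878381079, 2368158904440])]),
  (63634230500051104282747178448528309289462, [(0, [5941016793092]), (1, [5640907337990, 6675725775111,
    8118298018068, 7088042635543, 3463626903844, 5666677141798, 5660771561797, 5636612370758,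
    6607006298439, 422253392200, 5662382174550, 7019323158904]), (2, [3467134763009,
    4888500133890, 7086718271493, 169136631816, 7088059400211, 5666693722147, 5666690576436,
    7088060448821, 5666694770744]), (4, [7857157178386, 6951137403928, 7857107252261,
    3651529040984])]),
  (73162386035302176265752661226461880451534, [(1, [7972018413574, 7078730090247, 7972051813910,
    6872571660055, 5636682559781, 5636178842406, 5636950995253, 1238125466422, 5636145688901,
    5636078580038, 5635071947094, 6597693753191, 275466516072, 7010010613624]), (2,
    [7078730089473, 7083024990210, 5641238622211, 4879704876040, 5641272034067, 7082941416468,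
    4879675377176, 5636981265187, 7078730350884, 485923767848, 5636947849524, 485873640520])]),
  (84051421775187953330124591636484019782094, [(1, [3458646151425, 5649063743490, 3442221273350,
    305833074696, 5648963469588, 3442154411286, 305782916632, 5649064136740, 5649064005669,
    5649030578501, 5635071947094, 275466516072]), (2, [1260103610371, 1260153733907, 160646304547,
    160646042408, 160596177204, 508204040501, 1238930576182, 160529068360, 506861863256]), (3,
    [6627473379335, 6971070763031, 7108509716583, 7039790239864])]),
  (54106615004554432803215967323741536911820, [(0, [8131212034306, 8131212218371, 7848348357127,
    7985787109907, 7779628880407, 5714286220323, 4884720214580, 1597811941941, 1581672375862,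
    7718895175223, 486204057144, 4884804100677, 1599087010376, 4883730358870]), (1,
    [5641238622470, 1259617005832, 8130926941204, 5940241962005, 8130960495652, 5940778832933,
    5718581264999, 5856020218488]), (2, [5636978115350, 160643154712, 5705697346086,
    229362385448])]),
  (47300967665818747252410039240545298874878, [(2, [8126918361089, 8126917316611, 8126918365203]), (5,
    [1594075660290, 7912945696772, 6747516387333, 7766950494214, 1130420912135, 99628761096,
    1594075922450, 7913012805652, 6748590129173, 7784130363414, 1405298819095, 4497675272216,
    1594075988003, 1594076053540, 7913029582900, 6748858564661, 7788425330742, 1474018295863,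
    5597186900024, 1594008944709, 1594277380182, 1611457249383, 1199140388984])]),
  (51384065290738556205878909733217792492022, [(0, [8131182723348]), (2, [4906213900289, 4906197127172,
    7096110482438, 4906213901320, 8131197273106, 5939958842389, 7078930613270, 508167390232,
    8131197338660, 7092352386085, 5940227277893, 7083225580614, 1607679018056, 7091815515222]),
    (4, [5782956803079, 5508078896151, 6951187907624, 5714237326407, 5851676279928]), (5,
    [7791694594050, 3783956512773, 7791695839251, 7791694790691, 7791696887860, 7791693742133])]),
  (86773680709921634528773261479545020154366, [(0, [434666672136]), (2, [1607478673409, 1607696662530,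
    1259600293891, 1607663239172, 1451820986373, 1238398087174, 1109549068295, 1607478689813,
    1251282989078, 1315707498519, 1607478677528, 1607696859171, 1607696793636, 1607696728104,
    1607713570868, 1259621199925, 1259601342520, 1607747125317, 1607680016456, 1259872923734,
    1452089421912, 1246988021863, 1242693054568, 1178268545144]), (5, [5597185851411])]),
  (28243825912117380033502181024754260574686, [(1, [7078730272774, 7079267008790, 2681217626422,
    7835099738438]), (2, [2686053449729, 7083290411011, 8114003918852, 7083022025747,
    8113735533588, 6808060515380]), (4, [2555897971714, 5785596879879, 4754914829320,
    2556703096853, 5923035833367, 6953938084888, 2555898102819, 5648258827300, 2555897906214,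
    2557239967797, 5991755310135, 2557508403269, 8053449712712, 2556434661462, 5716877403239,
    3655403201640])]),
  (48662055595761453293160087263729411686908, [(0, [8131180642595, 8130425536805, 2705916576040,
    8131178545460, 2707173884216, 8131230843205, 3669881930054, 3669632237910]), (2,
    [8130964492290, 8131212218371, 5941015810052, 5940010160133, 3437959057414, 2230267875335,
    151740878856, 8130964557842, 8131213266963, 5941032587284, 5940278595605, 3442254024726,
    2298987352087, 1251252506648]), (3, [7770205086567, 8182521947000])])]

/-- Contraction certificates for graphs with 10 vertices. -/
def lvl10 : List (ℕ × List (ℕ × List ℕ)) := [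
  (7560193203825365513542575145361213866960749324, [(0, [148868987621378, 124546807136520,
    25315949838601, 148867914137877, 124546001999896, 25659245074457, 107233793819172,
    24220800139815, 107232451961925, 24219458282583]), (1, [148868985655299, 148868448911635,
    148846978289955, 148846978027814, 58773943167028, 148847515014453, 91278373103671,
    58774010275910, 148846441272662, 91553251010663, 17731308189800, 1376039172201]), (2,
    [62016429625417, 144273693610104, 150041800085641])]),
  (6668152506801607837506415421505836897084900332, [(0, [62080869863481, 148873568981095,
    148942288457848, 150041800085641]), (1, [55419443676163, 107976961623046, 107993756009763,
    55419062388006, 107994124715060, 55419058259253, 107994141492294, 107976576206166]), (2,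
    [3389906191112, 8887464330008, 3389654467672]), (3, [148868987621378, 148868182327557,
    58717708029970, 58716567650580, 95073701347364, 95073399357765]), (4, [148461252120583,
    8260637822985, 148529971597335, 25852823867417, 148459876521303, 8259262223705]), (5,
    [148868985651475, 113800582922518])]),
  (9879448929095808682400945576115077257616229342, [(1, [142345218686977, 142345218688004,
    141245707063304, 142345218703380, 142345218715671, 142345218691096, 124808870391833,
    132230573854791, 79673055907913, 148942288457848, 150041800085641]), (4, [97127484256377]), (5,
    [91294922121223, 3669001445385, 90264180305989, 90263374999639, 20160920891481]), (6,
    [148868987621378, 148868987818020, 148868987883557]), (7, [148868985655299, 113800582926342,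
    148868988801076, 148868989849653, 113813467828294, 113817762795606]), (8, [148868987752483,
    148868987949094, 113809174106169, 148873282916455])]),
  (8273751714639840732397881036016149902866842574, [(0, [124546807136520, 132243388530968,
    131143876903305]), (1, [141988739444738, 141851048964103, 141988739706916, 141988739575847,
    142126195306565, 142125926871127]), (4, [148731230294273, 25719656841481, 148723181158676,
    148584484045077, 7998574592329, 7859877478745]), (7, [148796508082179, 90642659229702,
    148796511227956, 148589598019637, 25646915027014, 25440001818710]), (9, [148868986703891,
    148868986732569, 25706508746857]), (10, [148868987752483, 148868987949094, 148593858449463,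
    148800016879719])]),
  (9790245948260148369553987895561186411011441550, [(0, [107857184834056, 110056208089624,
    106757673206392, 112255231345289]), (1, [141846485694209, 141846485693442, 124255101812743,
    141846468970260, 124255085070359, 141846485759012]), (4, [8058989346825, 8059006027801,
    25299038328873, 25298988205385, 24294301123193]), (7, [113259700257059, 113259683518516,
    55006049223991]), (8, [113809167814659, 113809201234195]), (10, [7981747044646, 7994631946566,
    7990336979303]), (11, [148868468707365, 148869005578309, 148869542449239]), (12, [148860684079158,
    148869274013782, 148870079320153])]),
  (6400535397538587605983559859284644022508323724, [(1, [142344397849603, 142344397850375,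
    124808096712457, 111291582661139, 144201132279075, 124533218805815, 145642932425016,
    71975653673017, 148941467308408, 150040978936201]), (2, [95795781318165, 95796049753637,
    95797123495477]), (3, [148868700389634, 143165873197576, 142066361569816]), (4, [107994538116116,
    55389912892438, 107994622002212, 55411387728934, 107994554893364, 55394207859766]), (5,
    [90196294238999, 2570405020441, 91295805620775, 3669916402217]), (13, [148869005578309,
    113818079465545, 148869274013782, 148873568981095])]),
  (6222132158230047571930315169901666667162567678, [(3, [130099466735618, 111267637825539,
    58716573536261, 148847799177222, 148461252120583, 141245707063304, 8131248132105, 148868736094243,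
    44488683819049, 148868737142837, 148869274013782, 148873568981095, 148942288457848,
    150041800085641]), (5, [95074489860097, 95074473086980]), (14, [148868987686930, 130103738109971,
    95073717194773, 113804340170774, 72672782651415, 36865370755096, 26896482045977,
    148868987818020, 130103740207156, 95074254065733, 113812930105414, 72810221604935,
    39064394010696, 62080854134857])]),
  (6132929177435925079369007963196041460115637246, [(1, [142344346485761]), (5, [148868733997059,
    148864377163780, 148867931836421, 148847799177222, 148461252120583, 141245707063304, 9304311730185,
    148868735045651, 148864393941012, 148868200271893, 148852094144534, 148529971597335,
    142345218691096, 26896497774617, 148868737142837, 148864979046470, 148736130027591,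
    145643753574472, 79673055907913, 148869274013782, 148873568981095, 148942288457848,
    150041800085641]), (14, [148868987621378, 148868987686930, 148868987752483, 148868987883557,
    148868988801076, 111335006736453])]),
  (6668152506469290697357802479083902416740746222, [(1, [113352829649921, 142344967045141]), (2,
    [3389906191112, 8887464330008, 4489417818968]), (4, [148461252120583, 9304311730185,
    132174734037011, 148529971597335, 26896497774617, 62080869863481, 148804849504343,
    97265241952345, 148942288457848, 150041800085641]), (5, [148868985655299, 113808131690501,
    113800582926342, 113812645610514, 113813434273812, 113800582922518, 113812645938211,
    113812645807142, 113813501382708, 148868164682805, 113813467828294, 113804055872598]), (14,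
    [113808921071618, 113808921333796, 113808904556613])]),
  (6668108949329413961600594088291507828825064430, [(1, [113352829649921, 142344967045141]), (2,
    [3389906191112, 53885839835913, 89070215070483, 8887464330008, 141846770058009, 35275743396665,
    4489417818968, 71478025880409, 91371307913]), (4, [148461252120583, 148852094144534,
    148529971597335, 148804849504343, 148873568981095]), (5, [148868985655299, 39062833729541,
    113800582926342, 148868164682805, 113804055872598]), (14, [73148499234818, 73147962360594,
    73148415741972, 132096909971492, 132096876417093]), (15, [148868987752483, 148868987949094,
    148867897311540, 148867947643206])]),
  (6222132158230047571935150910073331993743721460, [(1, [113353654681620, 144201179464996,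
    144201179661605, 129894912034089, 107993800049989, 107977693922630, 108042118432071,
    110103702734152, 73832435549513, 107994873791830, 107973398955367, 107904679478648,
    112302725989769]), (3, [148868671095059, 148868668997923, 148868666900788, 148868670046517]), (5,
    [79672987815940, 113817457853446, 79673004590089, 148868685628434, 95073415136277,
    113800277984278, 9304260412441]), (14, [148868987621378, 95073448759301]), (15, [148461252120583,
    106069119799304, 148529971597335, 107168631427096])]),
  (10682275755993721905697400396617470897390420990, [(1, [72941832463369]), (4, [8260330868995]), (5,
    [23229452660742, 20154256076854, 20153716191289, 23233747628137]), (6, [113353384329217,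
    113331843465220, 113284664856583, 141245707063304, 148529971617814, 113353384333335,
    142345218691096, 113353384353817, 113331910574132, 113331893796934, 148873568981095,
    148942288457848, 113696981717113, 150041800085641]), (7, [113331927023618, 113331927285795,
    113331927351332, 55346853003305]), (15, [8255820939539, 78624549372233]), (16, [148867931836421,
    148868737142837, 148869005578309, 148869274013782])]),
  (10593072775199599413136093226805333906481021950, [(4, [8260330868995, 24479250456841]), (7,
    [148529971593217, 113331927023618, 72937411915780, 55344974217221, 114831658192902,
    148461252120583, 141245707063304, 76017035587606, 148529971597335, 142345218691096,
    76017035591705, 113331927285795, 113331927351332, 113331927154725, 72937546133556,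
    55347121700917, 113813750943798, 55345242652741, 148517070987334, 113332195590230,
    148873568981095, 58426611155049, 148942288457848, 149011007934585, 150041800085641]), (16,
    [55273570402323, 148868994043961, 148869072687177])]),
  (11306696621552578720458906153932981662727078910, [(1, [77324451128329]), (4, [8259782332676]), (5,
    [79673005572097, 26895171403781, 79191969263623, 79673005576212, 79673005600791,
    79673005588505, 26896513581125, 26896447455305, 26895440822361, 79466847170681]), (7,
    [55345351704579, 58413804896262, 106069641793544, 58430984765462, 107169153421336,
    55345360093236, 55345352753205, 113813735215174, 113332179861590, 113834942664807,
    58426689798249, 113766223188088, 112666711560329]), (16, [148868987621378, 148868987752483,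
    148868987818020, 148868987883557, 148868994043961])]),
  (10593072775199598779303539576192667867619853294, [(1, [124271213102081, 124280069308423,
    140837970395144, 132028190310422, 124554947215383, 145236016906264, 78169300418585,
    142349798883431, 141937482023032, 124761105645689, 149634063417481]), (4, [96220762673170,
    96220757757971, 96220494303253, 96220763000867, 96220762738725, 96220761952313,
    96221031174230, 97261215420521]), (5, [79671730507781, 91399125405702, 3459135246345,
    79673005576212, 79673072685125, 90385513123910]), (14, [62080852168777]), (15, [8255822708994,
    8255822971172]), (16, [55273562013699, 55273563062324])]),
  (10682275755993721905702236081449185477818647534, [(4, [96220757753857, 8260330868995, 95671001972743,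
    24479250456841, 96220757757971, 96220757786647, 96220757774361, 25852013596729,
    96014599356537]), (7, [113331927023618, 58413574864902, 113331927285795, 113331927351332,
    2568784790309, 2568784724777, 55346970312756, 2570663838517, 113812962545718, 113331893796934,
    2570126967638, 5637268390761]), (8, [141245707063304, 148529971617814, 142345218691096,
    148873568981095, 148942288457848, 150041800085641]), (16, [148867931836421, 148869005578309,
    148869072687177])]),
  (9879448928680414792516981956273028030356587518, [(1, [124258862924805]), (4, [22157823861001]), (5,
    [91431606091777, 20170246926340, 90195410497543, 88133071220744, 90401568919572,
    91431606095893, 90401568927767, 91431606104088, 91431606112281, 20170314035269,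
    20170263703625, 90263374999639, 23261885182041, 90332094476408, 90539007881337,
    93630629359753]), (6, [113327884763138, 113327885025316, 113327884959781]), (7, [148525136633859,
    113319294959622, 113327885090851, 113327884894246, 148525140828212, 148525139779637,
    55350991601721, 113336474828870, 113332179861590])]),
  (6489746545296439443661617823255458033613997054, [(1, [111292273730565]), (5, [55345292967937,
    40982855233540, 148846742224902, 90194655522823, 35554083680264, 2568734846985, 55345292972053,
    55345292988439, 38852618563608, 55345292980249, 40982872010821, 148868217061446,
    40991510179911, 148851037192278, 90263374999639, 36653595308120, 20160920891481,
    41051641819256, 37753106935945]), (14, [148868685893652]), (15, [132092883173634,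
    132092883435812, 132092883370277]), (16, [130105347280899, 130105349378083, 130105349509158,
    130105350426676, 130105355669557, 130109644476519])]),
  (9834863091178770724555841814463812417606190078, [(1, [142343876715524, 148529636070405]), (4,
    [146725479530755, 148529904500999, 142345151594760, 26891598053641, 9295198822713,
    148461185024327, 141245639967048, 9299412009289, 146743198105944, 97265174856025, 148942221361528,
    149010940838265, 150041732989321]), (5, [91432361066497, 91432360636418, 91432361095186,
    91432361082901, 91432360701988, 91431555776581]), (7, [76005410697222, 76009706123299,
    76009705664550, 142340420542517, 76031180501078]), (16, [57339291308051, 57339291328534,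
    73831973064756, 57347881263174])]),
  (9879448928514261451343032051905386588499936230, [(4, [26895692353538, 26869907214342,
    26896246112521, 97247829360953, 97252108534089]), (5, [91427342647297, 91427074215941,
    21055129257234, 91428143759635, 91432344289556, 21029375575318, 3462138168601, 21055129519397,
    91428147953973, 91432411398469, 21046555444566, 21054324213081]), (8, [148524871409699,
    113328167979046, 148524872458292, 148516265877574]), (9, [148461252120583, 141245707063304,
    148529971597335, 142345218691096, 148942288457848, 149011007934585, 150041800085641])]),
  (9879448928597338042623266718850161214765204470, [(1, [132024415421444]), (5, [91432361066497,
    20033679937538, 90400545509381, 3472235974665, 91432344289556, 20033680199716, 90401619251269,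
    3472219197769]), (6, [148525390235154, 148525340132889, 148525390497317, 7786828432985]), (7,
    [72943680958483, 113328404070435, 148512506732596, 72943686201397, 55349616328761]), (8,
    [148503380975622, 148524855812134, 148516265877574, 148511970910294]), (10, [148461252120583,
    141245707063304, 148529971597335, 142345218691096, 148736130027591, 148942288457848,
    149011007934585, 150041800085641])]),
  (7560149646181826712657731856121436226002158558, [(1, [55405488440326, 55406561935382]), (2,
    [89096548991814]), (4, [148851806851126]), (5, [132084812414977, 113804637782019, 148851492274180,
    113804369396755, 148851223888916]), (6, [25701676058119, 113319024625161, 25839115011607,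
    148503396714009, 75937043604276, 25564237104695, 25289359197799, 7765908358761]), (15,
    [148864410587138, 148863605473557, 148864410914851, 148864410718244, 148864410849318,
    148864947650869, 148864142344517, 148864679215446]), (17, [141245707063304, 142345218691096,
    79673055907913, 147842776830056, 150041800085641])]),
  (602198727477116162165100239946633238365668126, [(0, [141993313531913, 124401127487513, 1255825176633,
    89216755398729]), (1, [23374017759028, 23374021953335, 23245235849030, 23236645914471,
    23249530816360, 23442741430136]), (4, [124400322379779, 124529092755460, 124400322380040,
    124401127458835, 124529897834516, 124401127462936]), (7, [42268970992931, 41882376750372,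
    126603925618984, 42266824037429, 41880229794885, 42268434650200]), (11, [126797238898726,
    126603933913127, 126805828833366, 126741372866647]), (12, [125642927702017, 125641585854466,
    125642927734805])]),
  (7649396184406604706266253126193802752084739022, [(1, [107975872107526, 107975755121942]), (4,
    [62058592882725, 62059096114470, 62059666624565, 62059661381686, 62059129753669,
    62059079422022, 62058324447318]), (5, [113800077460481, 113804372361218, 113804288787476,
    113800077721892]), (7, [58413574865673, 58413459846169, 111190018110499, 111190017979433,
    111190135096116, 111190101541705, 5637016732521]), (10, [54375980630280, 62072562024728,
    57674515513704]), (11, [148461252120583, 148529971597335, 148873568981095, 148942288457848,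
    150041800085641]), (16, [95073983533059, 95074000240915])]),
  (8363020030759584647404694723995316225073284046, [(1, [144191034250246, 144190917264662,
    79251632189545]), (4, [62058592882725, 62059096114470, 62059129753669, 62059079422022,
    62058324447318, 62058861318233]), (5, [3442490167305, 3442540283161, 73806989497641,
    73806939377993]), (6, [142318645765633]), (7, [111190129853187, 111190012867603, 111190018110499,
    111190135096116, 54357710439990]), (10, [7784178548999, 1599425642760, 8265214886167,
    9296007037208, 7990336979303, 4897960526184, 8196495409528, 499914015113]), (15,
    [44479576867074, 44479510024212, 44466692243492])]),
  (8363020030759583062851114664682867594557457358, [(4, [62076275982337, 62076275982594,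
    62054297849862, 62076259274772, 62054247695638, 62076276052004, 62058592882725,
    62076309606469, 62058324447318]), (7, [54392623620099, 5654347984905, 54392573462035,
    5654448243481, 111201393050659, 54384256026665, 111201409777716, 111207466348597, 54357710439990,
    54384272769097, 111206929477721, 5637016732521]), (12, [148461252120583, 141245707063304,
    148529971597335, 142345218691096, 148873568981095, 147842776830056, 148942288457848,
    150041800085641])]),
  (6400535397517818497758239659625214664068826060, [(1, [144200595619859, 107992930780436,
    144199253427477, 132157775545635, 107993048220964, 144201132475685, 107992997889332,
    144200327169333, 144192274105654, 72808659354937, 107993031443785, 144200864040278]), (2,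
    [43242007836198, 76355954030121, 43452461233719, 97246674957880, 95803565946471,
    96147163330168, 93948140074633]), (5, [130099526501394]), (14, [130103823568898,
    130103820619779]), (15, [44463166918662, 91433247707655, 143165877129736, 8255837638665,
    44467461885974, 91364528230935, 142066365501976, 25848023683097])]),
  (6400535397517818497777583063034859080979579852, [(1, [113353620259843, 142344397850375,
    113353620260616, 144199253443859, 107992930780436, 144199253427477, 141863361513239,
    105657038866200, 129894864651555, 107993048220964, 144201132475685, 55418303284532,
    129893791171893, 124533218805815, 57275037583416]), (3, [148868700389634]), (4, [62055366414342,
    8260397715465, 55411387728934, 94710590145577, 62059627939126, 25852047000889]), (13,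
    [145504905666885, 111360016326985, 145506516279638, 148873568981095, 148942288457848,
    150041800085641]), (16, [95039648891158, 8131488973081])]),
  (6132929177435926030104540356532728418379826174, [(1, [55420178990084]), (5, [90385196384257,
    148868418256898, 148868683677699, 148867881517061, 148846943748102, 54994663919623,
    35409613049864, 2424264216585, 148868687872019, 90385196388372, 55338261303319, 40907171188760,
    90385194438681, 148868418322468, 148868418388005, 148868418584614, 148868684726324,
    148868686823477, 148868688920630, 148868149952581, 148851238715462, 55063383396423,
    36509124677704, 20016450261065, 148869223694422, 38776867410023, 38708147933304,
    37608636305545]), (14, [148851811029014])]),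
  (6668108949433260294916941202876544388202824622, [(1, [26741641016325, 25642079258376,
    124598125758217, 26741590869781, 26741590886168, 142190311802649, 17945502058293, 1452823447353,
    22343544375128, 71821567625049, 19045009491849]), (4, [148863922077697, 148855315255298,
    148863922098196, 148863871681829, 148855315386406, 148863854989381, 148863905321030,
    148851020419158]), (5, [55280893710339, 55006019997703, 55280927114515, 55006053401879,
    55005751562583]), (6, [25576567309878, 25580862277223]), (7, [90739797537827, 90739797668903,
    90739881100084, 90739914654535])]),
  (958987511509751126098743262133117103958983598, [(1, [26741641016325, 25642079258376, 124254533617417,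
    26741590869781, 26741590886168, 141846719661849, 89070160480053, 89070161528633,
    23374336526167, 22343544375128, 71477975484249, 23443056002936]), (2, [1471146111745,
    1475424240386, 1471095980820, 1471146374181, 1475424502566, 1471163089733, 1471129535302,
    1479719469910]), (5, [38788219293699, 55006019997703, 38788252697875, 55006053401879]), (6,
    [90739797537827, 41124337431591, 90739881100084, 90739914654535]), (17, [132230855921718,
    132235150889063])]),
  (6043720752290085509864364027131266140181627884, [(0, [8874582111017, 8882630259513, 141915489071992,
    149612070466441]), (1, [39037081768962, 39033053271043, 39037081767941, 39033053270022,
    42268991180836, 42297177886772, 39038960816197, 39063118041158]), (4, [148529166503954,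
    148513062342675, 148513062326295, 42157338607687]), (7, [90166268215303]), (9, [25852572205321,
    8260386160921]), (12, [132097413023752, 123301320001560]), (13, [92939609317667, 92923502993702,
    92939606171957, 92940682862934, 92940948349271, 92944977830247]), (18, [148868955246612])]),
  (6311332416910618454588948965135765680976036764, [(1, [39038941679618, 39038941680643,
    39037063087379, 39037063070997, 42268975432995, 39038942138405, 90166199345972,
    42267901972533, 40962986894135, 39588949603896, 72574298437177, 90166484481609,
    35190903092856, 37389926348425]), (4, [39958229300772, 72600064636455, 39956082352965,
    72597917688663]), (7, [41126509757188, 41124631163924]), (10, [25315934109961,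
    148461236420889]), (11, [123374149963784, 124473661591576]), (13, [92938901594406,
    92921721725238, 92908836823382, 92943196561767]), (16, [113259185442823, 113259453808919])]),
  (6668152506469291172726777564687942376509735918, [(4, [132166177652995, 132174734037011,
    132156480704565]), (5, [113822053564417, 113808367435778, 113808128557061, 113800582926342,
    113812645610514, 113813434273812, 113820963111957, 113808099328291, 113808367632420,
    113812645807142, 113813501382708, 113822057759030, 113808334078021, 113813467828294,
    113804055872598]), (8, [25299575463943, 18084030406664, 7776108896265, 25711892324375,
    24681100173336, 113329225162777, 54367914123321, 25849331277911, 26880123428952,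
    148513597251673, 25780611801208, 19183542034569])]),
  (7560193203612482213697692419910721784960844766, [(1, [107975872414726, 107976945909782]), (4,
    [132152945692742]), (5, [55325696065537, 113804372608002, 113804637782019, 148852027047940,
    113804369396755, 148851221922836, 113804909363221, 113804372542499, 113804372673572,
    113804372411430, 113800348057908, 113804640927797, 113800342815030, 113805177798725,
    113804104056918]), (6, [25701676058119, 24670883907080, 113319024625161, 25839115011607,
    26869907162648, 148503396714009, 54357697857097, 25289359197799, 18073814140520, 7765908358761,
    25770395534968, 19173325768329])])]

/-- Contraction certificates for graphs with 11 vertices. -/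
def lvl11 : List (ℕ × List (ℕ × List ℕ)) := [
  (869622086308558474645516446976131211776042329442060, [(0, [142194596354057, 159786782398489,
    2683316590481545, 2700908776525978]), (1, [2682143778017282, 2682142704533781, 142121278805834,
    422221933090680]), (2, [2682143776051203, 2682143239307539, 2682143243501859, 2682143780245557,
    422368767080774, 142130707396967, 422350782109544, 142112722425706]), (3, [2674520497459208,
    150935203614730, 2674177453850904, 151004376203546]), (4, [2682143762419748, 2121118021455911,
    2682143225676101, 2121117484712279]), (5, [2541389396125734, 2254356947958068, 571829346662711,
    2541388322669142])]),
  (811162734428279628323995626802763021976692764444652, [(1, [1012058916261946, 2682148359376999,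
    2682217078853752, 2683316590481545, 2700908776525978]), (6, [2682143778017282, 2682142972723461,
    939499553099794, 939498396008724, 1521213297016868, 1521212995027269]), (7, [2682143776051203,
    1821410860339206, 2682143776047379, 1821410860335382, 2682142685598773, 1821409769886806]), (8,
    [2681736042516487, 132574171238410, 2681804761993239, 414049147949082, 2681734666917207,
    132572795639130]), (9, [2674520497459208, 1979753705902089, 2675620009087000, 1997345891946521,
    2674519121859928, 1979752330302809]), (10, [2682143778148387, 1821419450273830, 2682142687695924,
    2682142738027590])]),
  (1395762676074359950599673481590681348867654310496222, [(2, [2112794612858881, 2111695101235208,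
    2542579102126089, 2675620009111575, 2112794612863000, 2560171288170521, 2112794612887578,
    2121247108501575, 2682217078853752, 2683316590481545, 2119391682629770, 2700908776525978]), (8,
    [391672302674186]), (11, [2682143778017282, 2682143459512324, 2682143778213924, 2682143778279461,
    2682143509844037]), (12, [2682143776051203, 2681718580776967, 2682143779196980, 2682143780245557]),
    (13, [2682122589573126, 2682139769442374, 2682144064409686]), (14, [2682143745642516,
    432542955237450]), (15, [2682143778148387, 2682143778344998, 2682143785488442, 2682148073312359,
    2682354231742586]), (16, [2682079639900247]), (17, [1575008869683290])]),
  (1290534558142972120310497610517841892325686714632142, [(2, [2675263529840642, 2675125839360007,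
    2675263530102820, 2675263529971751, 2675400985702469, 2675400717267031]), (3, [2674520497459208,
    2542579102126089, 2675620009087000, 2560171288170521, 2683316590481545, 2684416102109322,
    2700908776525978]), (12, [935141451448323, 1216612134236166, 2682071301623860, 2681864388415541,
    1216581314555974, 1216650788941910]), (18, [2682143778078721, 148529971630090, 2681791880249364,
    2681860348002325, 1274429878472778, 1274498346225754]), (19, [2682143777099795, 2682143777132570,
    430326787772522]), (20, [2682143778148387, 2682143778344998, 2681868648845367,
    2682074807275623])]),
  (869616377143563078942471720539005614790431474255630, [(0, [142194596354057, 159786782398489,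
    1457107998874]), (2, [2682143776051203, 2682143239307539, 2121186205237539, 427865447765812,
    2121186741981237, 427865514874694, 142129902294887, 422350782109544, 142112722425706]), (3,
    [2674520497459208, 150935203614730, 2674177453850904, 151004376203546, 146610357244280]), (4,
    [2682143762419748, 2121118021455911, 2682143795974213, 2121255460409431]), (9, [2682143778017537,
    2682143778017282, 2682142704533781]), (10, [1470598786060838, 1470596907475286]), (21,
    [2681942200946743]), (22, [1011994476023882])]),
  (1015775104515264076977607844086829264940984893507470, [(2, [2559672555173633, 2559672555171847,
    2559672538433303]), (4, [2674520497459208, 2542579102126089, 2675620009087000, 2560171288170521,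
    2682217078853752, 2665724404437113, 2683316590481545, 2700908776525978]), (12, [1779046079345699,
    1779046213042996, 1820801255051575, 148456155091322]), (13, [2588282607715626, 2588282741412938]),
    (14, [1820801258066178, 1820801207900436, 1820801258262820]), (15, [1821419445227523,
    149070318735370, 1821419478647059, 149070352154906]), (23, [2682143259103269, 2682143795974213,
    2682144332845143]), (24, [2682131179507750, 2682139769442374, 2682148359376999]), (25,
    [2682135474475062, 2682144064409686, 2682145138151514])]),
  (793624179554257147917840949595391724470460416001932, [(5, [2254433856599827, 2121182714400823,
    2114997961494584, 2595355660259385, 1012058916261946, 2682217078853752, 2683316590481545,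
    2700908776525978]), (6, [2682143490785538, 2682143490969603, 1780287683957795]), (8,
    [886582333998119, 1515374102512682]), (10, [1463005283881480, 2572129082020361, 1461905772253720,
    2554536895975961]), (14, [1821423237859591, 2682143240358154, 885551391114260, 1779218238735382,
    885551542109220, 1779256893441062, 885551407891508, 1779222533702710]), (17, [2120971457921303,
    167633166270746]), (26, [2682142990667797, 2682143259103269, 2682143527538741]), (27,
    [2682143795974213, 1821428356878410, 2682144064409686, 2682148359376999])]),
  (811162734428279732170328945567729246242510493714348, [(5, [1781862484746498, 1781828259287813,
    1781828159021332, 1781828159025429, 1781828259353125, 1781862485205286, 571837116749621,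
    422372252751674, 1781828175798597, 1781828125466950, 1781841010368854, 2254227344103255,
    2255258136254296, 2304736159504217, 853312092411738, 2254158624626552, 2251959601371017,
    2392697089726362]), (28, [2682143776051203, 2120980535316487, 2682143759335699, 2120980518600983]),
    (29, [2674520497459208, 150866438000650, 2675620009087000, 432341414711322, 673005688600355,
    1233687900337959, 673005538210612, 673005554987847]), (30, [2542579102126089, 2560171288170521,
    672971312689974, 672975607657319])]),
  (787777994630278076354134552099159616655830275327772, [(1, [141993313532218, 142122083907914,
    2270647824906633, 2393793127217562]), (3, [422381667717386, 2674181481402650]), (5,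
    [2254356411225908, 2254227564304183, 2254356444780358, 2254365034714983, 2254352149813096,
    2254158844827512]), (18, [2375087743734787, 2375023303496708, 2375087743733768, 2375088548825363,
    2375024108587284, 2375088548808984, 321575291205155, 321639637071396, 321575291467304,
    321572875887413, 321637221753669, 321573949629272]), (22, [2542579102126089, 2560171288170521]),
    (31, [2682143778017282, 2682142704533781]), (32, [2682131179507750, 2681873465741351,
    2682144064409686, 2682079624171607])]),
  (869623513512693791529073837277420521535124459292510, [(2, [430047363503880, 413554689087241,
    2112300154001162, 432246386759448, 448739061176089, 2675250107422490, 1152426502952778,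
    422350782109544, 290409386776425, 141975317026666, 431146875131785, 308001572820890]), (8,
    [2121255912407041, 2681847125790980, 2681847930885396]), (11, [639299055267846,
    639299591996182]), (16, [886758158980131, 886758159504420, 886758158914598, 886758167368756,
    886756548756789, 886758696240453, 1727884403758150, 886756280321366]), (28, [2121319613337603,
    2121319344963859]), (33, [2682143778017282, 2682005534150677, 2682143778410535, 2681937619980359,
    2682006339457111]), (34, [2681942200946743, 2682148359376999])])]

/-- Contraction certificates for graphs with 12 vertices. -/
def lvl12 : List (ℕ × List (ℕ × List ℕ)) := [
  (106033281090967261163085886438798211913963599201372213004, [(0, [47719312864186505, 47736905050230938,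
    48018380026941611]), (1, [47718140051722242, 47718138978238741]), (2, [47718140049756163,
    47718139513012499, 47718139517206819, 47718140053950517]), (3, [47446633980497928,
    2685309505638411, 47446290936889624, 2685378678227227]), (4, [47578575375831049, 36198423920250890,
    47596167561875481, 36479898896961562]), (5, [47718140036124708, 33946482087432231,
    47718140069679173, 33946619526385751]), (6, [47718127453212710, 47718126648099158]), (7,
    [10768159469105972, 5737275447735095, 47718140086456390, 33946688245862503]), (8,
    [16493118195109963, 38741529875058808]), (9, [47717113840930920, 29443024479195243])])]


theorem lvl6_ok : lall lvl6 (grOk 5 [276707635146073636894]) = true := by decide +kernel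

theorem lvl6_lf : ∀ p ∈ lvl6, LF 6 p.1 := fun p hp =>
  level_sound 5 (by norm_num) [276707635146073636894] (fun _ _ => LF_five _) p ((lall_iff _ _).1 lvl6_ok p hp)

theorem lvl7_ok : lall lvl7 (grOk 6 (lvl6.map Prod.fst)) = true := by decide +kernel

theorem lvl7_lf : ∀ p ∈ lvl7, LF 7 p.1 := fun p hp =>
  level_sound 6 (by norm_num) (lvl6.map Prod.fst)
    (fun M hM => by
      obtain ⟨q, hq, rfl⟩ := List.mem_map.1 hM
      exact lvl6_lf q hq) p ((lall_iff _ _).1 lvl7_ok p hp)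

theorem lvl8_ok : lall lvl8 (grOk 7 (lvl7.map Prod.fst)) = true := by decide +kernel

theorem lvl8_lf : ∀ p ∈ lvl8, LF 8 p.1 := fun p hp =>
  level_sound 7 (by norm_num) (lvl7.map Prod.fst)
    (fun M hM => by
      obtain ⟨q, hq, rfl⟩ := List.mem_map.1 hM
      exact lvl7_lf q hq) p ((lall_iff _ _).1 lvl8_ok p hp)

theorem lvl9_ok : lall lvl9 (grOk 8 (lvl8.map Prod.fst)) = true := by decide +kernel

theorem lvl9_lf : ∀ p ∈ lvl9, LF 9 p.1 := fun p hp =>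
  level_sound 8 (by norm_num) (lvl8.map Prod.fst)
    (fun M hM => by
      obtain ⟨q, hq, rfl⟩ := List.mem_map.1 hM
      exact lvl8_lf q hq) p ((lall_iff _ _).1 lvl9_ok p hp)

theorem lvl10_ok : lall lvl10 (grOk 9 (lvl9.map Prod.fst)) = true := by decide +kernel

theorem lvl10_lf : ∀ p ∈ lvl10, LF 10 p.1 := fun p hp =>
  level_sound 9 (by norm_num) (lvl9.map Prod.fst)
    (fun M hM => by
      obtain ⟨q, hq, rfl⟩ := List.mem_map.1 hM
      exact lvl9_lf q hq) p ((lall_iff _ _).1 lvl10_ok p hp)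

theorem lvl11_ok : lall lvl11 (grOk 10 (lvl10.map Prod.fst)) = true := by decide +kernel

theorem lvl11_lf : ∀ p ∈ lvl11, LF 11 p.1 := fun p hp =>
  level_sound 10 (by norm_num) (lvl10.map Prod.fst)
    (fun M hM => by
      obtain ⟨q, hq, rfl⟩ := List.mem_map.1 hM
      exact lvl10_lf q hq) p ((lall_iff _ _).1 lvl11_ok p hp)

theorem lvl12_ok : lall lvl12 (grOk 11 (lvl11.map Prod.fst)) = true := by decide +kernel

theorem lvl12_lf : ∀ p ∈ lvl12, LF 12 p.1 := fun p hp =>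
  level_sound 11 (by norm_num) (lvl11.map Prod.fst)
    (fun M hM => by
      obtain ⟨q, hq, rfl⟩ := List.mem_map.1 hM
      exact lvl11_lf q hq) p ((lall_iff _ _).1 lvl12_ok p hp)

/-! ### The graphs -/

/-- Adjacency of `i < j` in the graph with `n` vertices. -/
def ga (n i j : ℕ) : Prop :=
  i < j ∧ ((j < 8 ∧ bit 10141436917354138192374902816780 i j = true) ∨ (8 ≤ i ∧ j = i + 1) ∨
    (i < 8 ∧ 8 ≤ j ∧ (i ≤ 1 ∨ (j = 8 ∧ (i = 6 ∨ i = 7)) ∨ (j + 1 = n ∧ (i = 4 ∨ i = 6)))))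

instance (n i j : ℕ) : Decidable (ga n i j) := by unfold ga; infer_instance

/-- The graph with `n` vertices: vertices `8, …, n - 1` form a path. -/
def GG (n : ℕ) : SimpleGraph (Fin n) where
  Adj x y := ga n x y ∨ ga n y x
  symm := ⟨fun _ _ h => h.symm⟩
  loopless := ⟨fun x h => by
    have h : (x : ℕ) < x := by rcases h with h | h <;> exact h.1
    omega⟩

theorem GG_adj {n : ℕ} (x y : Fin n) : (GG n).Adj x y ↔ ga n x y ∨ ga n y x := Iff.rfl

/-- The contraction of the path edge `t`, `t + 1`. -/
def shr (N t : ℕ) (ht : t < N) (v : Fin (N + 1)) : Fin N :=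
  ⟨if (v : ℕ) ≤ t then v else v - 1, by split <;> omega⟩

theorem shr_val (N t : ℕ) (ht : t < N) (v : Fin (N + 1)) :
    (shr N t ht v : ℕ) = if (v : ℕ) ≤ t then (v : ℕ) else v - 1 := rfl

theorem ga_shr {N t x y : ℕ} (ht : t < N) (ht8 : 8 ≤ t) (hy : y < N + 1) (h : ga (N + 1) x y) :
    (x = t ∧ y = t + 1) ∨
    ga N (if x ≤ t then x else x - 1) (if y ≤ t then y else y - 1) := by
  obtain ⟨h0, ⟨h1, h2⟩ | h1 | h1⟩ := h
  · right
    rw [if_pos (by omega), if_pos (by omega)]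
    exact ⟨h0, Or.inl ⟨h1, h2⟩⟩
  · by_cases hx : x = t
    · left; omega
    · right
      refine ⟨?_, Or.inr (Or.inl ?_)⟩ <;> split <;> split <;> omega
  · right
    refine ⟨?_, Or.inr (Or.inr ?_)⟩ <;> split <;> split <;> omega

theorem shr_hom {N t : ℕ} (ht : t < N) (ht8 : 8 ≤ t) (x y : Fin (N + 1))
    (h : (GG (N + 1)).Adj x y) : shr N t ht x = shr N t ht y ∨
      (GG N).Adj (shr N t ht x) (shr N t ht y) := by
  have key : ∀ x y : Fin (N + 1), ga (N + 1) x y → shr N t ht x = shr N t ht y ∨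
      ga N (shr N t ht x) (shr N t ht y) := by
    intro x y h
    rcases ga_shr ht ht8 y.2 h with ⟨h1, h2⟩ | h
    · left
      apply Fin.ext
      rw [shr_val, shr_val, if_pos (by omega), if_neg (by omega)]
      omega
    · exact Or.inr h
  rcases h with h | h
  · exact (key x y h).imp id Or.inl
  · exact (key y x h).imp Eq.symm Or.inr

theorem shr_inj {N t : ℕ} (ht : t < N) (x y : Fin (N + 1)) (h : shr N t ht x = shr N t ht y) :
    x = y ∨ ((x : ℕ) = t ∧ (y : ℕ) = t + 1) ∨ ((x : ℕ) = t + 1 ∧ (y : ℕ) = t) := by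
  have h := congrArg Fin.val h
  rw [shr_val, shr_val] at h
  rw [Fin.ext_iff]
  split at h <;> split at h <;> omega

/-! ### The graphs are linkless -/

/-- A vertex of large degree is not in the branch set of an interior path vertex. -/
theorem not_mem_interior {W V : Type} {P : SimpleGraph W} {G : SimpleGraph V} (hP : Good P)
    {z z' i i' j i'' : V}
    (hNi : ∀ x, G.Adj i x → x = z ∨ x = z' ∨ x = i' ∨ x = j)
    (hNi' : ∀ x, G.Adj i' x → x = z ∨ x = z' ∨ x = i ∨ x = i'')
    (hzi' : G.Adj z i') (hzi : G.Adj z i) (hzj : G.Adj z j) (hii' : i' ≠ i) (hji : j ≠ i)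
    (hu : ∀ f, Model P G f → ∃ w, i ∈ f w) {f : W → Set V} (hf : Model P G f)
    {w w' : W} (hi : i ∈ f w) (hi' : i' ∈ f w') (hww' : w' ≠ w)
    (hj : j ∉ f w) (hi'' : i'' ∉ f w') : z ∉ f w := by
  intro hz
  have hdis : ∀ {w₁ w₂ v}, v ∈ f w₁ → v ∈ f w₂ → w₁ = w₂ := fun h1 h2 => hf.disj _ _ _ h1 h2
  have hz' : z ∉ f w' := fun h => hww' (hdis h hz)
  have hiw' : i ∉ f w' := fun h => hww' (hdis h hi)
  have hi'w : i' ∉ f w := fun h => hww' (hdis hi' h)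
  -- the owner of the vertex `i''`
  obtain ⟨o, ho⟩ : ∃ o, ∀ x, i'' ∈ f x → x = o := by
    by_cases h : ∃ x, i'' ∈ f x
    · obtain ⟨x, hx⟩ := h
      exact ⟨x, fun y hy => hdis hy hx⟩
    · exact ⟨w, fun x hx => absurd ⟨x, hx⟩ h⟩
  have hsing : z' ∉ f w' → ∀ v ∈ f w', v = i' := by
    intro hz'' v hv
    by_contra hne
    obtain ⟨u, hu', hadj⟩ := hf.exists_nbr hi' hv (Ne.symm hne)
    rcases hNi' u hadj with rfl | rfl | rfl | rfl
    · exact hz' hu'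
    · exact hz'' hu'
    · exact hiw' hu'
    · exact hi'' hu'
  have hN : ∀ c, z' ∈ f c → c ≠ w' → ∀ x, P.Adj w' x → x = w ∨ x = c ∨ x = o := by
    intro c hc hcw x hx
    obtain ⟨v₁, h1, v₂, h2, h⟩ := hf.adj _ _ hx
    rw [hsing (fun h => hcw (hdis hc h)) v₁ h1] at h
    rcases hNi' _ h with rfl | rfl | rfl | rfl
    · exact Or.inl (hdis h2 hz)
    · exact Or.inr (Or.inl (hdis h2 hc))
    · exact Or.inl (hdis h2 hi)
    · exact Or.inr (Or.inr (ho _ h2))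
  by_cases hA : z' ∈ f w
  · obtain ⟨x, hx, h1, h2⟩ := hP.deg w' w o
    rcases hN w hA hww'.symm x hx with h | h | h
    · exact h1 h
    · exact h1 h
    · exact h2 h
  have key : ∀ w₂ v₂, P.Adj w w₂ → v₂ ∈ f w₂ → G.Adj i v₂ → ∃ u ∈ f w₂, u ≠ i ∧ G.Adj z u := by
    intro w₂ v₂ hadj h2 h
    rcases hNi _ h with rfl | rfl | rfl | rfl
    · exact absurd (hdis hz h2) hadj.ne
    · by_cases hw : w₂ = w'
      · subst hw
        exact ⟨i', hi', hii', hzi'⟩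
      · exfalso
        have hN' := hN w₂ h2 hw
        have aw : P.Adj w' w := by
          obtain ⟨x, hx, h1, h2⟩ := hP.deg w' w₂ o
          rcases hN' x hx with rfl | h | h
          · exact hx
          · exact absurd h h1
          · exact absurd h h2
        have aw2 : P.Adj w' w₂ := by
          obtain ⟨x, hx, h1, h2⟩ := hP.deg w' w o
          rcases hN' x hx with h | rfl | h
          · exact absurd h h1
          · exact hx
          · exact absurd h h2
        exact hP.tri w' w w₂ o hN' aw aw2 hadj
    · exact ⟨_, h2, hii', hzi'⟩
    · exact ⟨_, h2, hji, hzj⟩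
  classical
  let ψ : V → V := fun v => if v = i then z else v
  have ψi : ψ i = z := if_pos rfl
  have ψn : ∀ v, v ≠ i → ψ v = v := fun v hv => if_neg hv
  have hiw : ∀ {x}, i ∈ f x → x = w := fun h => hdis h hi
  have hin : ∀ y ∈ f w, G.Adj i y → y = z := by
    intro y hy h
    rcases hNi _ h with rfl | rfl | rfl | rfl
    · rfl
    · exact absurd hy hA
    · exact absurd hy hi'w
    · exact absurd hy hj
  have hnew : Model P G (fun w => ψ '' f w) := by
    refine hf.map ψ ?_ ?_ ?_
    · intro u x hx y hy h
      by_cases hxi : x = i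
      · subst hxi
        have := hiw hx
        subst this
        left
        rw [hin y hy h, ψi, ψn z hzi.ne]
      · by_cases hyi : y = i
        · subst hyi
          have := hiw hy
          subst this
          left
          rw [hin x hx h.symm, ψi, ψn z hzi.ne]
        · right
          rw [ψn x hxi, ψn y hyi]
          exact h
    · intro w₁ w₂ h
      obtain ⟨v₁, h1, v₂, h2, ha⟩ := hf.adj _ _ h
      by_cases hx : v₁ = i
      · subst hx
        have := hiw h1
        subst this
        obtain ⟨u, hu1, hu2, hu3⟩ := key w₂ v₂ h h2 ha
        refine ⟨v₁, h1, u, hu1, ?_⟩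
        rw [ψi, ψn u hu2]
        exact hu3
      · by_cases hy : v₂ = i
        · subst hy
          have := hiw h2
          subst this
          obtain ⟨u, hu1, hu2, hu3⟩ := key w₁ v₁ h.symm h1 ha.symm
          refine ⟨u, hu1, v₂, h2, ?_⟩
          rw [ψi, ψn u hu2]
          exact hu3.symm
        · refine ⟨v₁, h1, v₂, h2, ?_⟩
          rw [ψn _ hx, ψn _ hy]
          exact ha
    · intro w₁ w₂ x hx y hy h
      by_cases hxi : x = i
      · subst hxi
        by_cases hyi : y = x
        · subst hyi
          exact hdis hx hy
        · rw [ψi, ψn y hyi] at h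
          subst h
          exact (hiw hx).trans (hdis hz hy)
      · by_cases hyi : y = i
        · subst hyi
          rw [ψi, ψn x hxi] at h
          subst h
          exact (hdis hx hz).trans (hiw hy).symm
        · rw [ψn x hxi, ψn y hyi] at h
          subst h
          exact hdis hx hy
  obtain ⟨u, x, hx, hxi⟩ := hu _ hnew
  by_cases h : x = i
  · rw [h, ψi] at hxi
    exact hzi.ne hxi
  · rw [ψn x h] at hxi
    exact h hxi

theorem GG_linkless_step (N : ℕ) (hN : 12 ≤ N) (hprev : ∀ i < 7, ¬ IsMinor (PG i) (GG N)) :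
    ∀ i < 7, ¬ IsMinor (PG i) (GG (N + 1)) := by
  intro k hk hm
  have hP := good_PG k hk
  -- in every model, consecutive path vertices are in different branch sets
  have hsep : ∀ f, Model (PG k) (GG (N + 1)) f → ∀ t (_ : 8 ≤ t) (ht : t < N),
      ∃ w₁ w₂, (⟨t, by omega⟩ : Fin (N + 1)) ∈ f w₁ ∧ (⟨t + 1, by omega⟩ : Fin (N + 1)) ∈ f w₂ ∧
        w₁ ≠ w₂ := by
    intro f hf t ht8 ht
    by_contra hcon
    push Not at hcon
    refine hprev k hk (hf.contract (shr N t ht) ⟨t, by omega⟩ ⟨t + 1, by omega⟩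
      (shr_hom ht ht8) ?_ hcon)
    intro x y hxy
    rcases shr_inj ht x y hxy with h | ⟨h1, h2⟩ | ⟨h1, h2⟩
    · exact Or.inl h
    · exact Or.inr (Or.inl ⟨Fin.ext h1, Fin.ext h2⟩)
    · exact Or.inr (Or.inr ⟨Fin.ext h1, Fin.ext h2⟩)
  obtain ⟨f, hf⟩ := (isMinor_iff _ _).1 hm
  have hdis : ∀ {w₁ w₂ v}, v ∈ f w₁ → v ∈ f w₂ → w₁ = w₂ := fun h1 h2 => hf.disj _ _ _ h1 h2
  let v : ℕ → Fin (N + 1) := fun t => if h : t < N + 1 then ⟨t, h⟩ else ⟨0, by omega⟩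
  have vv : ∀ t (h : t < N + 1), v t = ⟨t, h⟩ := fun t h => dif_pos h
  have vval : ∀ t, t < N + 1 → (v t : ℕ) = t := fun t h => by rw [vv t h]
  have hsep' : ∀ g, Model (PG k) (GG (N + 1)) g → ∀ t, 8 ≤ t → t < 12 →
      ∃ w₁ w₂, v t ∈ g w₁ ∧ v (t + 1) ∈ g w₂ ∧ w₁ ≠ w₂ := by
    intro g hg t h1 h2
    rw [vv t (by omega), vv (t + 1) (by omega)]
    exact hsep g hg t h1 (by omega)
  obtain ⟨a8, a9, m8, m9, n89⟩ := hsep' f hf 8 (by omega) (by omega)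
  obtain ⟨b9, a10, m9', m10, n910⟩ := hsep' f hf 9 (by omega) (by omega)
  obtain ⟨b10, a11, m10', m11, n1011⟩ := hsep' f hf 10 (by omega) (by omega)
  obtain ⟨b11, a12, m11', m12, n1112⟩ := hsep' f hf 11 (by omega) (by omega)
  obtain rfl := hdis m9 m9'
  obtain rfl := hdis m10 m10'
  obtain rfl := hdis m11 m11'
  -- neighbourhoods
  have hnb : ∀ t, 9 ≤ t → t < 12 → ∀ x, (GG (N + 1)).Adj (v t) x →
      x = v 0 ∨ x = v 1 ∨ x = v (t + 1) ∨ x = v (t - 1) := by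
    intro t h1 h2 x hx
    simp only [Fin.ext_iff, vval 0 (by omega), vval 1 (by omega), vval (t + 1) (by omega),
      vval (t - 1) (by omega)]
    rw [GG_adj, vval t (by omega)] at hx
    rcases hx with ⟨h0, ⟨h, -⟩ | h | h⟩ | ⟨h0, ⟨h, -⟩ | h | h⟩ <;> omega
  have had : ∀ z t, z ≤ 1 → 8 ≤ t → t < 13 → (GG (N + 1)).Adj (v z) (v t) := by
    intro z t h1 h2 h3
    rw [GG_adj, vval z (by omega), vval t (by omega)]
    exact Or.inl ⟨by omega, Or.inr (Or.inr ⟨by omega, h2, Or.inl h1⟩)⟩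
  have vne : ∀ s t, s < 13 → t < 13 → s ≠ t → v s ≠ v t := by
    intro s t h1 h2 h h'
    have := congrArg Fin.val h'
    rw [vval s (by omega), vval t (by omega)] at this
    exact h this
  have hused : ∀ t, 9 ≤ t → t < 12 → ∀ g, Model (PG k) (GG (N + 1)) g → ∃ w, v t ∈ g w := by
    intro t h1 h2 g hg
    obtain ⟨w, -, h, -⟩ := hsep' g hg t (by omega) h2
    exact ⟨w, h⟩
  have hz9 : ∀ z z', (z = 0 ∧ z' = 1) ∨ (z = 1 ∧ z' = 0) → v z ∉ f a9 := by
    intro z z' hzz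
    refine not_mem_interior hP (z' := v z') (i := v 9) (i' := v 10) (j := v 8) (i'' := v 11) ?_ ?_
      (had _ _ (by omega) (by omega) (by omega)) (had _ _ (by omega) (by omega) (by omega))
      (had _ _ (by omega) (by omega) (by omega)) (vne _ _ (by omega) (by omega) (by omega))
      (vne _ _ (by omega) (by omega) (by omega))
      (hused 9 (by omega) (by omega)) hf m9 m10 n910.symm (fun h => n89 (hdis m8 h))
      (fun h => n1011 (hdis h m11))
    · intro x hx
      rcases hzz with ⟨rfl, rfl⟩ | ⟨rfl, rfl⟩ <;>
        rcases hnb 9 (by omega) (by omega) x hx with h | h | h | h <;> simp [h]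
    · intro x hx
      rcases hzz with ⟨rfl, rfl⟩ | ⟨rfl, rfl⟩ <;>
        rcases hnb 10 (by omega) (by omega) x hx with h | h | h | h <;> simp [h]
  have hz10 : ∀ z z', (z = 0 ∧ z' = 1) ∨ (z = 1 ∧ z' = 0) → v z ∉ f a10 := by
    intro z z' hzz
    refine not_mem_interior hP (z' := v z') (i := v 10) (i' := v 9) (j := v 11) (i'' := v 8) ?_ ?_
      (had _ _ (by omega) (by omega) (by omega)) (had _ _ (by omega) (by omega) (by omega))
      (had _ _ (by omega) (by omega) (by omega)) (vne _ _ (by omega) (by omega) (by omega))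
      (vne _ _ (by omega) (by omega) (by omega))
      (hused 10 (by omega) (by omega)) hf m10 m9 n910 (fun h => n1011 (hdis h m11))
      (fun h => n89 (hdis m8 h))
    · intro x hx
      rcases hzz with ⟨rfl, rfl⟩ | ⟨rfl, rfl⟩ <;>
        rcases hnb 10 (by omega) (by omega) x hx with h | h | h | h <;> simp [h]
    · intro x hx
      rcases hzz with ⟨rfl, rfl⟩ | ⟨rfl, rfl⟩ <;>
        rcases hnb 9 (by omega) (by omega) x hx with h | h | h | h <;> simp [h]
  have hz11 : ∀ z z', (z = 0 ∧ z' = 1) ∨ (z = 1 ∧ z' = 0) → v z ∉ f a11 := by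
    intro z z' hzz
    refine not_mem_interior hP (z' := v z') (i := v 11) (i' := v 10) (j := v 12) (i'' := v 9) ?_ ?_
      (had _ _ (by omega) (by omega) (by omega)) (had _ _ (by omega) (by omega) (by omega))
      (had _ _ (by omega) (by omega) (by omega)) (vne _ _ (by omega) (by omega) (by omega))
      (vne _ _ (by omega) (by omega) (by omega))
      (hused 11 (by omega) (by omega)) hf m11 m10 n1011 (fun h => n1112 (hdis h m12))
      (fun h => n910 (hdis m9 h))
    · intro x hx
      rcases hzz with ⟨rfl, rfl⟩ | ⟨rfl, rfl⟩ <;>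
        rcases hnb 11 (by omega) (by omega) x hx with h | h | h | h <;> simp [h]
    · intro x hx
      rcases hzz with ⟨rfl, rfl⟩ | ⟨rfl, rfl⟩ <;>
        rcases hnb 10 (by omega) (by omega) x hx with h | h | h | h <;> simp [h]
  -- the branch sets of the interior vertices are singletons
  have hsing : ∀ t, 9 ≤ t → t < 12 → ∀ w, v t ∈ f w → v 0 ∉ f w → v 1 ∉ f w → v (t + 1) ∉ f w →
      v (t - 1) ∉ f w → ∀ y ∈ f w, y = v t := by
    intro t h1 h2 w hw g0 g1 g2 g3 y hy
    by_contra hne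
    obtain ⟨u, hu, hadj⟩ := hf.exists_nbr hw hy (Ne.symm hne)
    rcases hnb t h1 h2 u hadj with rfl | rfl | rfl | rfl
    · exact g0 hu
    · exact g1 hu
    · exact g2 hu
    · exact g3 hu
  have s9 := hsing 9 (by omega) (by omega) a9 m9 (hz9 0 1 (by omega)) (hz9 1 0 (by omega))
    (fun h => n910 (hdis h m10)) (fun h => n89 (hdis m8 h))
  have s10 := hsing 10 (by omega) (by omega) a10 m10 (hz10 0 1 (by omega)) (hz10 1 0 (by omega))
    (fun h => n1011 (hdis h m11)) (fun h => n910 (hdis m9 h))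
  have s11 := hsing 11 (by omega) (by omega) a11 m11 (hz11 0 1 (by omega)) (hz11 1 0 (by omega))
    (fun h => n1112 (hdis h m12)) (fun h => n1011 (hdis m10 h))
  have hown : ∀ x, ∃ o, ∀ w, x ∈ f w → w = o := by
    intro x
    by_cases h : ∃ w, x ∈ f w
    · obtain ⟨o, ho⟩ := h
      exact ⟨o, fun w hw => hdis hw ho⟩
    · exact ⟨a9, fun w hw => absurd ⟨w, hw⟩ h⟩
  obtain ⟨p, hp⟩ := hown (v 0)
  obtain ⟨q, hq⟩ := hown (v 1)
  have hNP : ∀ t, 9 ≤ t → t < 12 → ∀ w c d, (∀ y ∈ f w, y = v t) → v (t - 1) ∈ f c →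
      v (t + 1) ∈ f d → ∀ x, (PG k).Adj w x → x = c ∨ x = d ∨ x = p ∨ x = q := by
    intro t h1 h2 w c d hs hc hd x hx
    obtain ⟨v₁, g1, v₂, g2, ha⟩ := hf.adj _ _ hx
    rw [hs v₁ g1] at ha
    rcases hnb t h1 h2 v₂ ha with rfl | rfl | rfl | rfl
    · exact Or.inr (Or.inr (Or.inl (hp _ g2)))
    · exact Or.inr (Or.inr (Or.inr (hq _ g2)))
    · exact Or.inr (Or.inl (hdis g2 hd))
    · exact Or.inl (hdis g2 hc)
  have n911 : a9 ≠ a11 := by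
    intro h
    exact vne 9 11 (by omega) (by omega) (by omega) (s11 _ (h ▸ m9))
  exact hP.pat a9 a10 a11 p q a8 a12 n910 n1011 n911
    (hNP 9 (by omega) (by omega) a9 a8 a10 s9 m8 m10)
    (hNP 10 (by omega) (by omega) a10 a9 a11 s10 m9 m11)
    (hNP 11 (by omega) (by omega) a11 a10 a12 s11 m10 m12)

theorem GG10 : ∃ p ∈ lvl10, ∀ x y : Fin 10, (GG 10).Adj x y ↔ (gr 10 p.1).Adj x y := by
  refine ⟨_, List.mem_cons_self, ?_⟩
  simp only [GG_adj, gr_adj]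
  decide +kernel

theorem GG11 : ∃ p ∈ lvl11, ∀ x y : Fin 11, (GG 11).Adj x y ↔ (gr 11 p.1).Adj x y := by
  refine ⟨_, List.mem_cons_self, ?_⟩
  simp only [GG_adj, gr_adj]
  decide +kernel

theorem GG12 : ∃ p ∈ lvl12, ∀ x y : Fin 12, (GG 12).Adj x y ↔ (gr 12 p.1).Adj x y := by
  refine ⟨_, List.mem_cons_self, ?_⟩
  simp only [GG_adj, gr_adj]
  decide +kernel

theorem LF_transfer {n M : ℕ} (h : LF n M) (he : ∀ x y : Fin n, (GG n).Adj x y ↔ (gr n M).Adj x y) :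
    ∀ i < 7, ¬ IsMinor (PG i) (GG n) := by
  have : GG n = gr n M := by
    ext x y
    exact he x y
  rw [this]
  exact h

theorem GG_linkless_big (n : ℕ) (hn : 12 ≤ n) : ∀ i < 7, ¬ IsMinor (PG i) (GG n) := by
  induction n, hn using Nat.le_induction with
  | base =>
    obtain ⟨p, hp, h⟩ := GG12
    exact LF_transfer (lvl12_lf p hp) h
  | succ N hN ih => exact GG_linkless_step N hN ih

theorem GG_linkless (n : ℕ) (hn : 10 ≤ n) : ∀ i < 7, ¬ IsMinor (PG i) (GG n) := by
  rcases Nat.lt_or_ge n 12 with h | h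
  · obtain rfl | rfl : n = 10 ∨ n = 11 := by omega
    · obtain ⟨p, hp, h⟩ := GG10
      exact LF_transfer (lvl10_lf p hp) h
    · obtain ⟨p, hp, h⟩ := GG11
      exact LF_transfer (lvl11_lf p hp) h
  · exact GG_linkless_big n h

/-! ### Maximality -/

theorem addEdge_adj {V : Type} (G : SimpleGraph V) (a b x y : V) : (addEdge G a b).Adj x y ↔
    G.Adj x y ∨ (((x = a ∧ y = b) ∨ (x = b ∧ y = a)) ∧ x ≠ y) := by
  simp [addEdge]

theorem addEdge_comm {V : Type} (G : SimpleGraph V) (a b : V) : addEdge G a b = addEdge G b a := by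
  rw [addEdge, addEdge, Sym2.eq_swap]

/-- Minors of the graphs with 10 vertices and one additional edge: the edge, the index of
the minor, and (packed) the branch sets, the parents in spanning trees and their roots. -/
def mins10 : List (ℕ × ℕ × ℕ × ℕ × ℕ × ℕ) := [
  (0, 1, 5, 516508692582, 654820258304, 36781372994),
  (1, 2, 6, 453239980320, 654820258320, 581586604320),
  (0, 4, 6, 363052015920, 654820258320, 375349842720),
  (1, 4, 6, 435830276400, 654820258320, 435830330400),
  (0, 5, 6, 435809755440, 654820258320, 302686475040),
  (2, 5, 5, 302663275782, 620460519952, 27651556657),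
  (0, 6, 6, 453189637920, 654820258320, 580513059120),
  (1, 6, 6, 645708005760, 654820258320, 624522646560),
  (3, 6, 5, 431764083460, 620460519952, 31830582577),
  (0, 7, 6, 298090766640, 654820258320, 362514289440),
  (1, 7, 6, 646211322240, 654820258320, 624790033440),
  (4, 7, 5, 431730660100, 620460519952, 31295808817),
  (2, 8, 6, 444683403600, 654820258320, 444681376800),
  (3, 8, 5, 284950991620, 36344967696, 26934782001),
  (4, 8, 5, 491072340098, 620460519952, 6819106882),
  (5, 8, 6, 303203557680, 654820258320, 508019938080),
  (2, 9, 6, 507497693520, 654820258320, 432048133920),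
  (3, 9, 5, 156638712580, 620460519952, 27736942897),
  (5, 9, 6, 431515836720, 654820258320, 302683525920),
  (7, 9, 5, 431512425220, 620460519952, 27804050737)]

/-- Minors of the graphs with 11 vertices and one additional edge: the edge, the index of
the minor, and (packed) the branch sets, the parents in spanning trees and their roots. -/
def mins11 : List (ℕ × ℕ × ℕ × ℕ × ℕ × ℕ) := [
  (0, 1, 5, 2780474527812, 5052866769408, 40922797154),
  (1, 2, 6, 5950799028482, 11649936523792, 581593022497),
  (0, 4, 6, 5043691983369, 11031461245456, 18664284721),
  (1, 4, 6, 8068502991363, 11649936523792, 509634478657),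
  (0, 5, 6, 10331413943043, 11649936535568, 715003331633),
  (2, 5, 6, 10331413943043, 11649936535568, 715003331633),
  (0, 6, 6, 7251854431520, 11649936405008, 654884360496),
  (1, 6, 6, 10330321338752, 11649935487504, 693259957280),
  (3, 6, 6, 5950799024642, 11649936535568, 581593022513),
  (0, 7, 6, 7234930414089, 11031461245456, 31579464241),
  (1, 7, 6, 7251097363202, 11649936523792, 654618075217),
  (4, 7, 6, 10331330449922, 11649936535568, 706413420593),
  (2, 8, 6, 10327115846405, 11649936523792, 714995147857),
  (3, 8, 6, 4851032597765, 11649936535568, 577556333393),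
  (4, 8, 6, 10331414008322, 11649936535568, 715003346993),
  (5, 8, 6, 7251872125442, 11649936535568, 654888484913),
  (2, 9, 6, 4851032597762, 11649936523792, 577558429777),
  (3, 9, 6, 5044255795208, 11649936535568, 620495520593),
  (4, 9, 6, 5043691983362, 11649936535568, 637139574833),
  (5, 9, 6, 4851036787202, 11649936535568, 577561575473),
  (6, 9, 6, 5942242644487, 11615576797712, 442543456817),
  (7, 9, 6, 7234930414082, 11649936535568, 650054754353),
  (2, 10, 6, 6908338648323, 11649936523792, 448726107217),
  (3, 10, 6, 10326042420485, 11649936535568, 714189861713),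
  (5, 10, 6, 9441231966722, 11649936535568, 662639570993),
  (7, 10, 6, 5950547366402, 11649936535568, 577566490673),
  (8, 10, 5, 8144370610256, 11649932341264, 37196609088)]

/-- Adjacency in a packed graph with an additional edge. -/
noncomputable def eadj (M a b x y : ℕ) : Bool :=
  bor (adjb M x y) (bor (band (Nat.beq x a) (Nat.beq y b)) (band (Nat.beq x b) (Nat.beq y a)))

/-- Check of a minor certificate. -/
noncomputable def minOk (n M : ℕ) (c : ℕ × ℕ × ℕ × ℕ × ℕ × ℕ) : Bool :=
  force c.1 fun a => force c.2.1 fun b => force c.2.2.1 fun i => force c.2.2.2.1 fun asg =>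
  force c.2.2.2.2.1 fun par => force c.2.2.2.2.2 fun rt =>
  band (band (Nat.blt a b) (band (Nat.blt b n) (Nat.blt i 7)))
  (band (fall (psz i) fun w => band (Nat.blt (dg rt w) n) (Nat.beq (dg asg (dg rt w)) w))
  (band (fall n fun v => band (Nat.blt (dg par v) n) (band (Nat.beq (dg asg (dg par v)) (dg asg v))
    (band (bor (Nat.beq (dg par v) v) (eadj M a b v (dg par v)))
      (bor (bnot (Nat.blt (dg asg v) (psz i)))
        (Nat.beq (dg par (dg par (dg par v))) (dg rt (dg asg v)))))))
  (fall (psz i) fun w₁ => fall (psz i) fun w₂ => bor (bnot (adjb (pM i) w₁ w₂))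
    (fany n fun v₁ => band (Nat.beq (dg asg v₁) w₁)
      (fany n fun v₂ => band (Nat.beq (dg asg v₂) w₂) (eadj M a b v₁ v₂))))))

theorem minOk_sound {n M a b i asg par rt : ℕ} (h : minOk n M (a, b, i, asg, par, rt) = true)
    (x y : Fin n) (hx : (x : ℕ) = a) (hy : (y : ℕ) = b) :
    ∃ i < 7, IsMinor (PG i) (addEdge (gr n M) x y) := by
  have hE : ∀ u v : Fin n, u ≠ v → eadj M a b u v = true → (addEdge (gr n M) x y).Adj u v := by
    intro u v huv h
    rw [addEdge_adj]
    simp only [eadj, bor_iff, band_iff, nbeq_iff] at h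
    rcases h with h | h | h
    · exact Or.inl h
    · exact Or.inr ⟨Or.inl ⟨Fin.ext (h.1.trans hx.symm), Fin.ext (h.2.trans hy.symm)⟩, huv⟩
    · exact Or.inr ⟨Or.inr ⟨Fin.ext (h.1.trans hy.symm), Fin.ext (h.2.trans hx.symm)⟩, huv⟩
  simp only [minOk, force_eq, band_iff, fall_iff, fany_iff, bor_iff, bnot_iff, nbeq_iff,
    Nat.blt_eq] at h
  obtain ⟨⟨hab, hb, hi⟩, hrt, hpar, hadj⟩ := h
  refine ⟨i, hi, (isMinor_iff _ _).2 ⟨fun w => {v | dg asg v = w}, ?_, ?_, ?_⟩⟩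
  · intro w
    obtain ⟨r1, r2⟩ := hrt w w.2
    have step : ∀ v (hv : v < n) (hw : dg asg v = w), ∃ (h1 : dg par v < n)
        (h2 : dg asg (dg par v) = w),
        ((addEdge (gr n M) x y).induce {v : Fin n | dg asg v = w}).Reachable
          ⟨⟨v, hv⟩, hw⟩ ⟨⟨dg par v, h1⟩, h2⟩ := by
      intro v hv hw
      obtain ⟨p1, p2, p3, p4⟩ := hpar v hv
      refine ⟨p1, p2.trans hw, ?_⟩
      by_cases he : dg par v = v
      · have : (⟨⟨v, hv⟩, hw⟩ : {v : Fin n | dg asg v = w}) = ⟨⟨dg par v, p1⟩, p2.trans hw⟩ :=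
          Subtype.ext (Fin.ext he.symm)
        rw [this]
      · apply SimpleGraph.Adj.reachable
        exact hE ⟨v, hv⟩ ⟨dg par v, p1⟩ (fun h => he (congrArg Fin.val h).symm)
          (p3.resolve_left he)
    have root : ∀ v : {v : Fin n | dg asg v = w},
        ((addEdge (gr n M) x y).induce {v : Fin n | dg asg v = w}).Reachable
          v ⟨⟨dg rt w, r1⟩, r2⟩ := by
      rintro ⟨⟨v, hv⟩, hw⟩
      obtain ⟨-, -, -, p4⟩ := hpar v hv
      have hw' : dg asg v = w := hw
      obtain ⟨h1, g1, e1⟩ := step v hv hw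
      obtain ⟨h2, g2, e2⟩ := step _ h1 g1
      obtain ⟨h3, g3, e3⟩ := step _ h2 g2
      have p5 := p4.resolve_left (fun h => h (by rw [hw']; exact w.2))
      have : (⟨⟨dg rt w, r1⟩, r2⟩ : {v : Fin n | dg asg v = w}) =
          ⟨⟨dg par (dg par (dg par v)), h3⟩, g3⟩ :=
        Subtype.ext (Fin.ext ((p5.trans (by rw [hw'])).symm))
      rw [this]
      exact (e1.trans e2).trans e3
    have : Nonempty {v : Fin n | dg asg v = w} := ⟨⟨⟨dg rt w, r1⟩, r2⟩⟩
    exact ⟨fun u v => (root u).trans (root v).symm⟩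
  · intro w₁ w₂ v h1 h2
    exact Fin.ext (h1.symm.trans h2)
  · intro w₁ w₂ h
    obtain ⟨v₁, l1, e1, v₂, l2, e2, he⟩ := (hadj w₁ w₁.2 w₂ w₂.2).resolve_left (fun h' => h' h)
    refine ⟨⟨v₁, l1⟩, e1, ⟨v₂, l2⟩, e2, hE _ _ ?_ he⟩
    intro h'
    have h'' : v₁ = v₂ := congrArg Fin.val h'
    rw [h''] at e1
    exact h.ne (Fin.ext (e1.symm.trans e2))

/-- All nonadjacent pairs are covered by certificates. -/
noncomputable def covOk (n M : ℕ) (l : List (ℕ × ℕ × ℕ × ℕ × ℕ × ℕ)) : Bool :=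
  fall n fun y => fall y fun x => bor (adjb M x y)
    (lany l fun c => band (Nat.beq c.1 x) (Nat.beq c.2.1 y))

theorem max_base {n M : ℕ} (l : List (ℕ × ℕ × ℕ × ℕ × ℕ × ℕ))
    (he : ∀ x y : Fin n, (GG n).Adj x y ↔ (gr n M).Adj x y)
    (hl : lall l (minOk n M) = true) (hc : covOk n M l = true) (x y : Fin n) (hxy : x < y)
    (hadj : ¬ (GG n).Adj x y) : ∃ i < 7, IsMinor (PG i) (addEdge (GG n) x y) := by
  have : GG n = gr n M := by
    ext x y
    exact he x y
  rw [this] at hadj ⊢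
  rw [lall_iff] at hl
  simp only [covOk, fall_iff, bor_iff, lany_iff, band_iff, nbeq_iff] at hc
  obtain ⟨⟨a, b, i, asg, par, rt⟩, hmem, h1, h2⟩ := (hc y y.2 x hxy).resolve_left hadj
  exact minOk_sound (hl _ hmem) x y h1.symm h2.symm

theorem max10 (x y : Fin 10) (hxy : x < y) (hadj : ¬ (GG 10).Adj x y) :
    ∃ i < 7, IsMinor (PG i) (addEdge (GG 10) x y) := by
  refine max_base (M := 7560193203825365513542575145361213866960749324) mins10 ?_ ?_ ?_ x y hxy hadj
  · simp only [GG_adj, gr_adj]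
    decide +kernel
  · decide +kernel
  · decide +kernel

theorem max11 (x y : Fin 11) (hxy : x < y) (hadj : ¬ (GG 11).Adj x y) :
    ∃ i < 7, IsMinor (PG i) (addEdge (GG 11) x y) := by
  refine max_base (M := 869622086308558474645516446976131211776042329442060) mins11 ?_ ?_ ?_ x y hxy hadj
  · simp only [GG_adj, gr_adj]
    decide +kernel
  · decide +kernel
  · decide +kernel

theorem max_step (N : ℕ) (hN : 11 ≤ N) (ih : ∀ x y : Fin N, x < y → ¬ (GG N).Adj x y →
    ∃ i < 7, IsMinor (PG i) (addEdge (GG N) x y)) (x y : Fin (N + 1)) (hxy : x < y)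
    (hadj : ¬ (GG (N + 1)).Adj x y) : ∃ i < 7, IsMinor (PG i) (addEdge (GG (N + 1)) x y) := by
  have hna : ¬ ga (N + 1) x y := fun h => hadj (Or.inl h)
  have hxy' : (x : ℕ) < y := hxy
  have hy := y.2
  -- choice of the path edge to contract
  obtain ⟨t, ht8, ht, hlt, hn⟩ : ∃ t, 8 ≤ t ∧ ∃ ht : t < N,
      (shr N t ht x : ℕ) < shr N t ht y ∧ ¬ ga N (shr N t ht x) (shr N t ht y) := by
    simp only [shr_val]
    unfold ga at hna ⊢
    by_cases hy8 : (y : ℕ) < 8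
    · refine ⟨8, le_rfl, by omega, ?_⟩
      rw [if_pos (by omega), if_pos (by omega)]
      refine ⟨hxy, ?_⟩
      rintro ⟨h0, ⟨h1, h2⟩ | h1 | h1⟩
      · exact hna ⟨h0, Or.inl ⟨h1, h2⟩⟩
      · omega
      · omega
    · have hna' : ¬ ((8 ≤ (x : ℕ) ∧ (y : ℕ) = x + 1) ∨ ((x : ℕ) < 8 ∧ 8 ≤ (y : ℕ) ∧ ((x : ℕ) ≤ 1 ∨
          ((y : ℕ) = 8 ∧ ((x : ℕ) = 6 ∨ (x : ℕ) = 7)) ∨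
          ((y : ℕ) + 1 = N + 1 ∧ ((x : ℕ) = 4 ∨ (x : ℕ) = 6))))) :=
        fun h => hna ⟨hxy, Or.inr h⟩
      by_cases hc : ((x : ℕ) < 8 ∧ (y : ℕ) ≤ 9) ∨ ((x : ℕ) = 8 ∧ (y : ℕ) = 10)
      · refine ⟨N - 1, by omega, by omega, ?_⟩
        rw [if_pos (by omega), if_pos (by omega)]
        refine ⟨hxy, ?_⟩
        rintro ⟨h0, ⟨h1, -⟩ | h1 | h1⟩ <;> omega
      · refine ⟨8, le_rfl, by omega, ?_⟩
        rw [if_neg (show ¬ (y : ℕ) ≤ 8 by omega)]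
        split
        · refine ⟨by omega, ?_⟩
          rintro ⟨h0, ⟨h1, -⟩ | h1 | h1⟩ <;> omega
        · refine ⟨by omega, ?_⟩
          rintro ⟨h0, ⟨h1, -⟩ | h1 | h1⟩ <;> omega
  obtain ⟨i, hi, hm⟩ := ih (shr N t ht x) (shr N t ht y) hlt (by
    rintro (h | h)
    · exact hn h
    · have := h.1
      omega)
  refine ⟨i, hi, hm.lift (shr N t ht) ?_ ?_ ?_⟩
  · intro c
    refine ⟨⟨if (c : ℕ) ≤ t then c else c + 1, by split <;> omega⟩, Fin.ext ?_⟩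
    rw [shr_val]
    by_cases h : (c : ℕ) ≤ t
    · simp [h]
    · simp only [if_neg h]
      rw [if_neg (by omega)]
      omega
  · intro u v h
    rcases shr_inj ht u v h with h | ⟨h1, h2⟩ | ⟨h1, h2⟩
    · exact Or.inl h
    · right
      rw [addEdge_adj]
      exact Or.inl (Or.inl ⟨by omega, Or.inr (Or.inl ⟨by omega, by omega⟩)⟩)
    · right
      rw [addEdge_adj]
      exact Or.inl (Or.inr ⟨by omega, Or.inr (Or.inl ⟨by omega, by omega⟩)⟩)
  · have key : ∀ a b : Fin N, ga N a b → ∃ u v : Fin (N + 1), shr N t ht u = a ∧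
        shr N t ht v = b ∧ (GG (N + 1)).Adj u v := by
      intro a b h
      have hb := b.2
      suffices ∃ u v : ℕ, ∃ (hu : u < N + 1) (hv : v < N + 1),
          (if u ≤ t then u else u - 1) = a ∧ (if v ≤ t then v else v - 1) = b ∧
          ga (N + 1) u v by
        obtain ⟨u, v, hu, hv, h1, h2, h3⟩ := this
        exact ⟨⟨u, hu⟩, ⟨v, hv⟩, Fin.ext h1, Fin.ext h2, Or.inl h3⟩
      obtain ⟨h0, ⟨h1, h2⟩ | h1 | h1⟩ := h
      · exact ⟨a, b, by omega, by omega, if_pos (by omega), if_pos (by omega), h0,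
          Or.inl ⟨h1, h2⟩⟩
      · by_cases hat : (a : ℕ) < t
        · exact ⟨a, b, by omega, by omega, if_pos (by omega), if_pos (by omega), h0,
            Or.inr (Or.inl h1)⟩
        · refine ⟨a + 1, b + 1, by omega, by omega, ?_, ?_, by omega, Or.inr (Or.inl (by omega))⟩
          · rw [if_neg (by omega)]; omega
          · rw [if_neg (by omega)]; omega
      · by_cases hbt : (b : ℕ) < t ∨ (b : ℕ) = 8 ∧ ¬ (b : ℕ) + 1 = N
        · by_cases hbt' : (b : ℕ) ≤ t
          · refine ⟨a, b, by omega, by omega, if_pos (by omega), if_pos (by omega), h0,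
              Or.inr (Or.inr (by omega))⟩
          · omega
        · refine ⟨a, b + 1, by omega, by omega, if_pos (by omega), ?_, by omega,
            Or.inr (Or.inr (by omega))⟩
          rw [if_neg (by omega)]; omega
    intro a b hab
    rw [addEdge_adj] at hab
    have hne : x ≠ y := fun h => by rw [h] at hxy'; omega
    rcases hab with (h | h) | ⟨⟨rfl, rfl⟩ | ⟨rfl, rfl⟩, -⟩
    · obtain ⟨u, v, h1, h2, h3⟩ := key a b h
      exact ⟨u, v, h1, h2, (addEdge_adj _ _ _ _ _).2 (Or.inl h3)⟩
    · obtain ⟨u, v, h1, h2, h3⟩ := key b a h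
      exact ⟨v, u, h2, h1, (addEdge_adj _ _ _ _ _).2 (Or.inl h3.symm)⟩
    · exact ⟨x, y, rfl, rfl, (addEdge_adj _ _ _ _ _).2 (Or.inr ⟨Or.inl ⟨rfl, rfl⟩, hne⟩)⟩
    · exact ⟨y, x, rfl, rfl, (addEdge_adj _ _ _ _ _).2 (Or.inr ⟨Or.inr ⟨rfl, rfl⟩, hne.symm⟩)⟩

theorem GG_max_big (n : ℕ) (hn : 11 ≤ n) : ∀ x y : Fin n, x < y → ¬ (GG n).Adj x y →
    ∃ i < 7, IsMinor (PG i) (addEdge (GG n) x y) := by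
  induction n, hn using Nat.le_induction with
  | base => exact max11
  | succ N hN ih => exact max_step N hN ih

theorem GG_maxnil (n : ℕ) (hn : 10 ≤ n) : IsMaxnil (GG n) := by
  have hmax : ∀ x y : Fin n, x < y → ¬ (GG n).Adj x y →
      ∃ i < 7, IsMinor (PG i) (addEdge (GG n) x y) := by
    rcases Nat.lt_or_ge n 11 with h | h
    · obtain rfl : n = 10 := by omega
      exact max10
    · exact GG_max_big n h
  refine ⟨(isLinkless_iff _).2 (GG_linkless n hn), ?_⟩
  intro a b hab hadj hl
  rw [isLinkless_iff] at hl
  rcases lt_or_gt_of_ne hab with h | h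
  · obtain ⟨i, hi, hm⟩ := hmax a b h hadj
    exact hl i hi hm
  · obtain ⟨i, hi, hm⟩ := hmax b a h (fun h' => hadj h'.symm)
    rw [addEdge_comm] at hm
    exact hl i hi hm

/-! ### The number of edges -/

/-- The number of smaller neighbours of a vertex. -/
def low (n j : ℕ) : ℕ := ((Finset.range j).filter fun i => ga n i j).card

theorem low_small (n m : ℕ) : (∑ j ∈ Finset.range 8, low n j) = ∑ j ∈ Finset.range 8, low m j := by
  apply Finset.sum_congr rfl
  intro j hj
  have hj := Finset.mem_range.1 hj
  unfold low
  congr 1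
  apply Finset.filter_congr
  intro i hi
  have hi := Finset.mem_range.1 hi
  unfold ga
  constructor
  · rintro ⟨h0, h | h | h⟩
    · exact ⟨h0, Or.inl h⟩
    · omega
    · omega
  · rintro ⟨h0, h | h | h⟩
    · exact ⟨h0, Or.inl h⟩
    · omega
    · omega

theorem low_eight (n : ℕ) (hn : 10 ≤ n) : low n 8 = 4 := by
  have : (Finset.range 8).filter (fun i => ga n i 8) = {0, 1, 6, 7} := by
    ext i
    simp only [Finset.mem_filter, Finset.mem_range, Finset.mem_insert, Finset.mem_singleton]
    constructor
    · rintro ⟨h, h0, ⟨h1, -⟩ | h1 | h1⟩ <;> omega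
    · intro h
      exact ⟨by omega, by omega, Or.inr (Or.inr (by omega))⟩
  rw [low, this]
  rfl

theorem low_mid (n j : ℕ) (h9 : 9 ≤ j) (hj : j + 1 < n) : low n j = 3 := by
  have : (Finset.range j).filter (fun i => ga n i j) = {0, 1, j - 1} := by
    ext i
    simp only [Finset.mem_filter, Finset.mem_range, Finset.mem_insert, Finset.mem_singleton]
    constructor
    · rintro ⟨h, h0, ⟨h1, -⟩ | h1 | h1⟩ <;> omega
    · intro h
      exact ⟨by omega, by omega, Or.inr (by omega)⟩
  rw [low, this]
  rw [Finset.card_eq_three]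
  exact ⟨0, 1, j - 1, by omega, by omega, by omega, rfl⟩

theorem low_last (j : ℕ) (h9 : 9 ≤ j) : low (j + 1) j = 5 := by
  have : (Finset.range j).filter (fun i => ga (j + 1) i j) = insert (j - 1) {0, 1, 4, 6} := by
    ext i
    simp only [Finset.mem_filter, Finset.mem_range, Finset.mem_insert, Finset.mem_singleton]
    constructor
    · rintro ⟨h, h0, ⟨h1, -⟩ | h1 | h1⟩ <;> omega
    · intro h
      exact ⟨by omega, by omega, Or.inr (by omega)⟩
  rw [low, this, Finset.card_insert_of_notMem]
  · rfl
  · simp only [Finset.mem_insert, Finset.mem_singleton]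
    omega

theorem low_sum (n k : ℕ) (hn : 9 + k < n) : (∑ j ∈ Finset.range (9 + k), low n j) = 20 + 3 * k := by
  induction k with
  | zero =>
    rw [show 9 + 0 = 8 + 1 from rfl, Finset.sum_range_succ, low_eight n (by omega), low_small n 10]
    decide +kernel
  | succ k ih =>
    rw [← add_assoc, Finset.sum_range_succ, ih (by omega), low_mid n _ (by omega) (by omega)]
    ring

theorem GG_edges (n : ℕ) (hn : 10 ≤ n) : (GG n).edgeSet.ncard = 3 * n - 5 := by
  have hsum : (∑ j ∈ Finset.range n, low n j) = 3 * n - 5 := by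
    obtain ⟨k, rfl⟩ : ∃ k, n = 9 + k + 1 := ⟨n - 10, by omega⟩
    rw [Finset.sum_range_succ, low_sum _ _ (by omega), low_last _ (by omega)]
    omega
  rw [← hsum]
  unfold low
  rw [← Finset.card_sigma, ← Set.ncard_coe_finset]
  symm
  refine Set.ncard_congr (fun p hp => s((⟨p.2, ?_⟩ : Fin n), (⟨p.1, ?_⟩ : Fin n))) ?_ ?_ ?_
  · simp only [Finset.mem_coe, Finset.mem_sigma, Finset.mem_range, Finset.mem_filter] at hp
    omega
  · simp only [Finset.mem_coe, Finset.mem_sigma, Finset.mem_range, Finset.mem_filter] at hp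
    omega
  · intro p hp
    simp only [Finset.mem_coe, Finset.mem_sigma, Finset.mem_range, Finset.mem_filter] at hp
    rw [SimpleGraph.mem_edgeSet]
    exact Or.inl hp.2.2
  · rintro ⟨j, i⟩ ⟨j', i'⟩ hp hp' h
    simp only [Finset.mem_coe, Finset.mem_sigma, Finset.mem_range, Finset.mem_filter] at hp hp'
    rw [Sym2.eq_iff] at h
    simp only [Fin.ext_iff] at h
    obtain ⟨rfl, rfl⟩ : j = j' ∧ i = i' := by omega
    rfl
  · intro e
    induction e using Sym2.ind with
    | _ x y =>
      intro h
      rw [SimpleGraph.mem_edgeSet] at h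
      rcases h with h | h
      · refine ⟨⟨y, x⟩, ?_, rfl⟩
        simp only [Finset.mem_coe, Finset.mem_sigma, Finset.mem_range, Finset.mem_filter]
        exact ⟨y.2, h.1, h⟩
      · refine ⟨⟨x, y⟩, ?_, Sym2.eq_swap⟩
        simp only [Finset.mem_coe, Finset.mem_sigma, Finset.mem_range, Finset.mem_filter]
        exact ⟨x.2, h.1, h⟩

/-- For every `n ≥ 10` there exists a maxnil graph with `n` vertices and exactly
`3n - 5` edges. -/
theorem stmt_3 (n : ℕ) (hn : 10 ≤ n) :
    ∃ G : SimpleGraph (Fin n), IsMaxnil G ∧ G.edgeSet.ncard = 3 * n - 5 := by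
  exact ⟨GG n, GG_maxnil n hn, GG_edges n hn⟩
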